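/- arXiv:2007.11275 — 3 statements merged into one kernel-verified Lean document; each statement's English description precedes it below -/
import Mathlib

section
/- Continuity of Bony–Weyl operators: let m ∈ ℝ, s₀ > d/2, and let a ∈ Γ^m_{H^{s₀}}. Then, for ε in the cut-off small enough, Op^BW(a) extends to a bounded operator Ḣ^s(𝕋^d) → Ḣ^{s−m}(𝕋^d) for every s ∈ ℝ, with ‖Op^BW(a)u‖_{s−m} ≲ |a|_{m,s₀,2(d+1)} ‖u‖_s for all u ∈ Ḣ^s. Moreover, for every ϱ ≥ 0 and every s ∈ ℝ, ‖Op^BW(a)u‖_{s−m−ϱ} ≲ |a|_{m,s₀−ϱ,2(d+1)} ‖u‖_s for all u ∈ Ḣ^s(𝕋^d). -/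
/-!  Common setting: Sobolev spaces, paradifferential calculus and the
Euler–Korteweg system on the torus 𝕋^d = (ℝ/2πℤ)^d, modelled by
2π-periodic functions on ℝ^d and their Fourier coefficients. -/

noncomputable section
open scoped BigOperators Classical
open MeasureTheory

namespace EK

abbrev Rd (d : ℕ) := Fin d → ℝ
abbrev Zd (d : ℕ) := Fin d → ℤ
abbrev Fn (d : ℕ) := Rd d → ℂ
abbrev RFn (d : ℕ) := Rd d → ℝ
abbrev Symb (d : ℕ) := Rd d → Rd d → ℂ
abbrev Pair (d : ℕ) := Fn d × Fn d

variable {d : ℕ}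

/-- Integer vector seen as a real vector. -/
def zR (j : Zd d) : Rd d := fun i => (j i : ℝ)

def dot (x y : Rd d) : ℝ := ∑ i, x i * y i

/-- Euclidean norm on ℝ^d. -/
def enorm (x : Rd d) : ℝ := Real.sqrt (∑ i, (x i) ^ 2)

def normSq (x : Rd d) : ℝ := ∑ i, (x i) ^ 2

def znorm (j : Zd d) : ℝ := enorm (zR j)

/-- Japanese bracket ⟨ξ⟩ := max(1,|ξ|). -/
def jap (ξ : Rd d) : ℝ := max 1 (enorm ξ)

def japZ (j : Zd d) : ℝ := jap (zR j)

/-- 2π-periodicity in each variable. -/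
def Per (u : Fn d) : Prop :=
  ∀ (x : Rd d) (j : Zd d), u (fun i => x i + 2 * Real.pi * (j i : ℝ)) = u x

def PerR (u : RFn d) : Prop :=
  ∀ (x : Rd d) (j : Zd d), u (fun i => x i + 2 * Real.pi * (j i : ℝ)) = u x

/-- Fundamental domain of the torus. -/
def box (d : ℕ) : Set (Rd d) := Set.univ.pi fun _ => Set.Ioc (0 : ℝ) (2 * Real.pi)

/-- Fourier coefficient of a periodic function. -/
def fcoef (u : Fn d) (j : Zd d) : ℂ :=
  (((2 * Real.pi) ^ d)⁻¹ : ℝ) •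
    ∫ x in box d, u x * Complex.exp (-(Complex.I * (dot (zR j) x : ℝ)))

def toC (u : RFn d) : Fn d := fun x => (u x : ℂ)

/-- Square of the inhomogeneous Sobolev norm. -/
def sobSq (s : ℝ) (u : Fn d) : ℝ := ∑' j : Zd d, (japZ j) ^ (2 * s) * ‖fcoef u j‖ ^ 2
def sobNorm (s : ℝ) (u : Fn d) : ℝ := Real.sqrt (sobSq s u)
/-- Membership in H^s(𝕋^d). -/
def InHs (s : ℝ) (u : Fn d) : Prop :=
  Per u ∧ LocallyIntegrable u volume ∧
    Summable fun j : Zd d => (japZ j) ^ (2 * s) * ‖fcoef u j‖ ^ 2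

/-- Square of the homogeneous Sobolev norm. -/
def hsobSq (s : ℝ) (u : Fn d) : ℝ := ∑' j : Zd d, (znorm j) ^ (2 * s) * ‖fcoef u j‖ ^ 2
def hnorm (s : ℝ) (u : Fn d) : ℝ := Real.sqrt (hsobSq s u)
/-- Membership in Ḣ^s(𝕋^d) (zero-average representative of the quotient class). -/
def InHdot (s : ℝ) (u : Fn d) : Prop :=
  Per u ∧ LocallyIntegrable u volume ∧ fcoef u 0 = 0 ∧
    Summable fun j : Zd d => (znorm j) ^ (2 * s) * ‖fcoef u j‖ ^ 2

def sobNormR (s : ℝ) (u : RFn d) : ℝ := sobNorm s (toC u)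
def InHsR (s : ℝ) (u : RFn d) : Prop := InHs s (toC u)
/-- H^s_0 : zero-average Sobolev functions. -/
def InHs0R (s : ℝ) (u : RFn d) : Prop := InHs s (toC u) ∧ fcoef (toC u) 0 = 0
def hnormR (s : ℝ) (u : RFn d) : ℝ := hnorm s (toC u)
def InHdotR (s : ℝ) (u : RFn d) : Prop := InHdot s (toC u)

/-- Partial derivative ∂/∂x_i. -/
def pd {E : Type*} [NormedAddCommGroup E] [NormedSpace ℝ E]
    (i : Fin d) (f : Rd d → E) : Rd d → E :=
  fun x => deriv (fun t : ℝ => f (Function.update x i t)) (x i)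

/-- Iterated partial derivative ∂^β for a multi-index β. -/
def pdM {E : Type*} [NormedAddCommGroup E] [NormedSpace ℝ E]
    (β : Fin d → ℕ) (f : Rd d → E) : Rd d → E :=
  (List.finRange d).foldr (fun i g => (pd i)^[β i] g) f

/-- Length |β| of a multi-index. -/
def mOrder (β : Fin d → ℕ) : ℕ := ∑ i, β i

def lapR (f : RFn d) : RFn d := fun x => ∑ i, pd i (pd i f) x
def gradSq (f : RFn d) : RFn d := fun x => ∑ i, (pd i f x) ^ 2
def divRhoGrad (ρ φ : RFn d) : RFn d := fun x => ∑ i, pd i (fun y => ρ y * pd i φ y) x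

/-- L^∞ norm. -/
def supNorm (u : Fn d) : ℝ := ⨆ x : Rd d, ‖u x‖

/-- Hölder seminorm of exponent θ. -/
def holSemi (θ : ℝ) (u : Fn d) : ℝ :=
  ⨆ p : Rd d × Rd d, if p.1 = p.2 then 0 else ‖u p.1 - u p.2‖ / (enorm (p.1 - p.2)) ^ θ

/-- Hölder norm of W^{ϱ,∞}(𝕋^d). -/
def holNorm (ϱ : ℝ) (u : Fn d) : ℝ :=
  (⨆ α : {α : Fin d → ℕ // mOrder α ≤ ⌊ϱ⌋₊}, supNorm (pdM α.1 u)) +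
    (if (⌊ϱ⌋₊ : ℝ) = ϱ then 0
     else ⨆ α : {α : Fin d → ℕ // mOrder α = ⌊ϱ⌋₊}, holSemi (ϱ - ⌊ϱ⌋₊) (pdM α.1 u))

/-- Fourier coefficient (in x) of a symbol. -/
def scoef (a : Symb d) (j : Zd d) (ξ : Rd d) : ℂ := fcoef (fun x => a x ξ) j

/-- ∂_ξ^β of a symbol. -/
def sdxi (β : Fin d → ℕ) (a : Symb d) : Symb d := fun x ξ => pdM β (a x) ξ
/-- ∂_x^α of a symbol. -/
def sdx (α : Fin d → ℕ) (a : Symb d) : Symb d := fun x ξ => pdM α (fun y => a y ξ) x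

/-- A function of x regarded as a ξ-independent symbol. -/
def fsymb (u : Fn d) : Symb d := fun x _ => u x

/-- The symbol class Γ^m_{L^∞}. -/
structure SymbL (m : ℝ) (a : Symb d) : Prop where
  per : ∀ ξ, Per fun x => a x ξ
  smooth : ∀ x, ContDiff ℝ (⊤ : ℕ∞) (a x)
  loc : ∀ (β : Fin d → ℕ) (ξ : Rd d), LocallyIntegrable (fun x => sdxi β a x ξ) volume
  bound : ∀ β : Fin d → ℕ, ∃ C : ℝ,
    ∀ ξ, supNorm (fun x => sdxi β a x ξ) ≤ C * (jap ξ) ^ (m - (mOrder β : ℝ))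

/-- The symbol class Γ^m_{H^s}. -/
structure SymbH (s m : ℝ) (a : Symb d) : Prop where
  smooth : ∀ x, ContDiff ℝ (⊤ : ℕ∞) (a x)
  mem : ∀ (β : Fin d → ℕ) (ξ : Rd d), InHs s fun x => sdxi β a x ξ
  bound : ∀ β : Fin d → ℕ, ∃ C : ℝ,
    ∀ ξ, sobNorm s (fun x => sdxi β a x ξ) ≤ C * (jap ξ) ^ (m - (mOrder β : ℝ))

/-- The symbol class Γ^m_{W^{ϱ,∞}}. -/
structure SymbW (ϱ m : ℝ) (a : Symb d) : Prop where
  per : ∀ ξ, Per fun x => a x ξ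
  smooth : ∀ x, ContDiff ℝ (⊤ : ℕ∞) (a x)
  smoothx : ∀ (ξ : Rd d) (β : Fin d → ℕ), ContDiff ℝ (⌊ϱ⌋₊ : ℕ∞) fun x => sdxi β a x ξ
  loc : ∀ (β : Fin d → ℕ) (ξ : Rd d), LocallyIntegrable (fun x => sdxi β a x ξ) volume
  bound : ∀ β : Fin d → ℕ, ∃ C : ℝ,
    ∀ ξ, holNorm ϱ (fun x => sdxi β a x ξ) ≤ C * (jap ξ) ^ (m - (mOrder β : ℝ))

/-- Seminorm |a|_{m,L^∞,n}. -/
def snormL (m : ℝ) (n : ℕ) (a : Symb d) : ℝ :=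
  ⨆ β : {β : Fin d → ℕ // mOrder β ≤ n}, ⨆ ξ : Rd d,
    (jap ξ) ^ (-m + (mOrder β.1 : ℝ)) * supNorm fun x => sdxi β.1 a x ξ

/-- Seminorm |a|_{m,H^s,n}. -/
def snormH (s m : ℝ) (n : ℕ) (a : Symb d) : ℝ :=
  ⨆ β : {β : Fin d → ℕ // mOrder β ≤ n}, ⨆ ξ : Rd d,
    (jap ξ) ^ (-m + (mOrder β.1 : ℝ)) * sobNorm s fun x => sdxi β.1 a x ξ

/-- Seminorm |a|_{m,W^{ϱ,∞},n}. -/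
def snormW (ϱ m : ℝ) (n : ℕ) (a : Symb d) : ℝ :=
  ⨆ β : {β : Fin d → ℕ // mOrder β ≤ n}, ⨆ ξ : Rd d,
    (jap ξ) ^ (-m + (mOrder β.1 : ℝ)) * holNorm ϱ fun x => sdxi β.1 a x ξ

/-- Spectral localization with parameter δ: â(j,ξ) = 0 for |j| ≥ δ⟨ξ⟩. -/
def SpecLoc (δ : ℝ) (a : Symb d) : Prop :=
  ∀ (j : Zd d) (ξ : Rd d), δ * jap ξ ≤ znorm j → scoef a j ξ = 0

/-- Spectrally localized symbols (class Σ). -/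
def SpecLocS (a : Symb d) : Prop := ∃ δ ∈ Set.Ioo (0 : ℝ) 1, SpecLoc δ a

/-- Admissible cut-off function χ. -/
structure IsCutoff (χ : Rd d → ℝ) : Prop where
  smooth : ContDiff ℝ (⊤ : ℕ∞) χ
  even : ∀ ξ : Rd d, χ (-ξ) = χ ξ
  mem01 : ∀ ξ, χ ξ ∈ Set.Icc (0 : ℝ) 1
  eq_one : ∀ ξ, enorm ξ ≤ 1.1 → χ ξ = 1
  eq_zero : ∀ ξ, (1.9 : ℝ) ≤ enorm ξ → χ ξ = 0

/-- Radial evaluation of the cut-off at a scalar argument. -/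
def cut1 (χ : Rd d → ℝ) (t : ℝ) : ℝ := χ fun _ => t / Real.sqrt d

/-- Regularized symbol a_χ. -/
def achi (χ : Rd d → ℝ) (ε : ℝ) (a : Symb d) : Symb d := fun x ξ =>
  ∑' j : Zd d, (χ (fun i => (j i : ℝ) / (ε * jap ξ)) : ℂ) * scoef a j ξ *
    Complex.exp (Complex.I * (dot (zR j) x : ℝ))

/-- Weyl quantization. -/
def OpW (a : Symb d) (u : Fn d) : Fn d := fun x =>
  ∑' j : Zd d, (∑' k : Zd d,
      scoef a (j - k) (fun i => ((j i : ℝ) + (k i : ℝ)) / 2) * fcoef u k) *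
    Complex.exp (Complex.I * (dot (zR j) x : ℝ))

/-- Bony–Weyl paradifferential operator. -/
def OpBW (χ : Rd d → ℝ) (ε : ℝ) (a : Symb d) (u : Fn d) : Fn d := OpW (achi χ ε a) u

/-- Standard quantization. -/
def OpStd (a : Symb d) (u : Fn d) : Fn d := fun x =>
  ∑' k : Zd d, a x (zR k) * fcoef u k * Complex.exp (Complex.I * (dot (zR k) x : ℝ))

def e1 (i : Fin d) : Fin d → ℕ := fun k => if k = i then 1 else 0

/-- Poisson bracket {a,b} = ∇_ξ a·∇_x b − ∇_x a·∇_ξ b. -/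
def pbr (a b : Symb d) : Symb d := fun x ξ =>
  ∑ i, (sdxi (e1 i) a x ξ * sdx (e1 i) b x ξ - sdx (e1 i) a x ξ * sdxi (e1 i) b x ξ)

/-- The symbol a #_ϱ b. -/
def sharp (ϱ : ℝ) (a b : Symb d) : Symb d :=
  if ϱ ≤ 1 then fun x ξ => a x ξ * b x ξ
  else fun x ξ => a x ξ * b x ξ + (1 / (2 * Complex.I)) * pbr a b x ξ

/-- Projection Π₀^⊥ onto nonzero Fourier modes. -/
def proj0c (u : Fn d) : Fn d := fun x => u x - fcoef u 0

/-- The symbol of the triple-composition remainder R₁: {a,c}b + {b,c}a + {a,b}c. -/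
def trip (a b c : Symb d) : Symb d := fun x ξ =>
  pbr a c x ξ * b x ξ + pbr b c x ξ * a x ξ + pbr a b x ξ * c x ξ

/-- Bony paraproduct remainder R(u,v) := uv − Op^BW(u)v − Op^BW(v)u. -/
def Rbony (χ : Rd d → ℝ) (ε : ℝ) (u v : Fn d) : Fn d := fun x =>
  u x * v x - OpBW χ ε (fsymb u) v x - OpBW χ ε (fsymb v) u x

/-- Change of quantization: symbol b with Op^W(a) = Op(b). -/
def chq (a : Symb d) : Symb d := fun x ξ =>
  ∑' n : Zd d, scoef a n (fun i => ξ i + (n i : ℝ) / 2) *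
    Complex.exp (Complex.I * (dot (zR n) x : ℝ))

/-! ### Curves with values in Sobolev spaces -/

/-- Continuity (and membership) of a curve with respect to a norm functional. -/
def CCont (Nrm : Fn d → ℝ) (Mem : Fn d → Prop) (I : Set ℝ) (u : ℝ → Fn d) : Prop :=
  (∀ t ∈ I, Mem (u t)) ∧
    ∀ t ∈ I, ∀ η > (0 : ℝ), ∃ δ > (0 : ℝ), ∀ t' ∈ I, |t' - t| < δ →
      Nrm (fun x => u t' x - u t x) < η

/-- v is the derivative of the curve u in the topology given by the norm functional. -/
def CDeriv (Nrm : Fn d → ℝ) (I : Set ℝ) (u v : ℝ → Fn d) : Prop :=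
  ∀ t ∈ I, ∀ η > (0 : ℝ), ∃ δ > (0 : ℝ), ∀ t' ∈ I, |t' - t| < δ →
    Nrm (fun x => u t' x - u t x - ((t' - t : ℝ) : ℂ) * v t x) ≤ η * |t' - t|

def RCont (Nrm : RFn d → ℝ) (Mem : RFn d → Prop) (I : Set ℝ) (u : ℝ → RFn d) : Prop :=
  (∀ t ∈ I, Mem (u t)) ∧
    ∀ t ∈ I, ∀ η > (0 : ℝ), ∃ δ > (0 : ℝ), ∀ t' ∈ I, |t' - t| < δ →
      Nrm (fun x => u t' x - u t x) < η

def RDeriv (Nrm : RFn d → ℝ) (I : Set ℝ) (u v : ℝ → RFn d) : Prop :=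
  ∀ t ∈ I, ∀ η > (0 : ℝ), ∃ δ > (0 : ℝ), ∀ t' ∈ I, |t' - t| < δ →
    Nrm (fun x => u t' x - u t x - (t' - t) * v t x) ≤ η * |t' - t|

/-! ### The Euler–Korteweg system -/

/-- RHS of the ρ–equation of the EK system: −div(ρ∇φ). -/
def EKrho (ρ φ : RFn d) : RFn d := fun x => -(divRhoGrad ρ φ x)
/-- RHS of the φ–equation: −½|∇φ|² − g(ρ) + K(ρ)Δρ + ½K'(ρ)|∇ρ|². -/
def EKphi (K g : ℝ → ℝ) (ρ φ : RFn d) : RFn d := fun x =>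
  -(1 / 2) * gradSq φ x - g (ρ x) + K (ρ x) * lapR ρ x + (1 / 2) * deriv K (ρ x) * gradSq ρ x

/-- RHS of the ρ–equation with mean 𝚖: −𝚖Δφ − div(ρ∇φ). -/
def EKmrho (m : ℝ) (ρ φ : RFn d) : RFn d := fun x => -m * lapR φ x - divRhoGrad ρ φ x
/-- RHS of the φ–equation with mean 𝚖. -/
def EKmphi (K g : ℝ → ℝ) (m : ℝ) (ρ φ : RFn d) : RFn d := fun x =>
  -(1 / 2) * gradSq φ x - g (m + ρ x) + K (m + ρ x) * lapR ρ x
    + (1 / 2) * deriv K (m + ρ x) * gradSq ρ x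

/-- Solution of the EK system (statement on the full torus, inhomogeneous spaces),
on the time interval [−T,T], in C⁰H^s ∩ C¹H^{s−2}, with ρ > 0. -/
def Sol0 (K g : ℝ → ℝ) (s T : ℝ) (ρ φ : ℝ → RFn d) : Prop :=
  RCont (sobNormR s) (InHsR s) (Set.Icc (-T) T) ρ ∧
  RCont (sobNormR s) (InHsR s) (Set.Icc (-T) T) φ ∧
  RCont (sobNormR (s - 2)) (InHsR (s - 2)) (Set.Icc (-T) T)
    (fun t => EKrho (ρ t) (φ t)) ∧
  RCont (sobNormR (s - 2)) (InHsR (s - 2)) (Set.Icc (-T) T)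
    (fun t => EKphi K g (ρ t) (φ t)) ∧
  RDeriv (sobNormR (s - 2)) (Set.Icc (-T) T) ρ (fun t => EKrho (ρ t) (φ t)) ∧
  RDeriv (sobNormR (s - 2)) (Set.Icc (-T) T) φ (fun t => EKphi K g (ρ t) (φ t)) ∧
  ∀ t ∈ Set.Icc (-T) T, ∀ x, 0 < ρ t x

/-- Solution of the EK system with fixed mean 𝚖, on [0,T], with
ρ(t) ∈ C⁰H^s_0 ∩ C¹H^{s−2}_0, φ(t) ∈ C⁰Ḣ^s ∩ C¹Ḣ^{s−2} (φ–equation modulo constants),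
and 𝚖₁ < 𝚖 + ρ < 𝚖₂. -/
def Sol1 (K g : ℝ → ℝ) (m m1 m2 s T : ℝ) (ρ φ : ℝ → RFn d) : Prop :=
  RCont (sobNormR s) (InHs0R s) (Set.Icc 0 T) ρ ∧
  RCont (hnormR s) (InHdotR s) (Set.Icc 0 T) φ ∧
  RCont (sobNormR (s - 2)) (InHs0R (s - 2)) (Set.Icc 0 T)
    (fun t => EKmrho m (ρ t) (φ t)) ∧
  RDeriv (sobNormR (s - 2)) (Set.Icc 0 T) ρ (fun t => EKmrho m (ρ t) (φ t)) ∧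
  (∃ c : ℝ → ℝ,
    RCont (hnormR (s - 2)) (InHdotR (s - 2)) (Set.Icc 0 T)
      (fun t => fun x => EKmphi K g m (ρ t) (φ t) x - c t) ∧
    RDeriv (hnormR (s - 2)) (Set.Icc 0 T) φ
      (fun t => fun x => EKmphi K g m (ρ t) (φ t) x - c t)) ∧
  ∀ t ∈ Set.Icc (0 : ℝ) T, ∀ x, m1 < m + ρ t x ∧ m + ρ t x < m2

/-! ### Complex coordinates -/

/-- ρ(U) = (1/√2)(𝚖/K(𝚖))^{1/4} Π₀^⊥(u+ū). -/
def rhoU (K : ℝ → ℝ) (m : ℝ) (u : Fn d) : RFn d := fun x =>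
  (1 / Real.sqrt 2) * (m / K m) ^ ((1 : ℝ) / 4) * (2 * (u x).re - 2 * (fcoef u 0).re)

/-- φ(U) = (1/(i√2))(𝚖/K(𝚖))^{−1/4}(u−ū). -/
def phiU (K : ℝ → ℝ) (m : ℝ) (u : Fn d) : RFn d := fun x =>
  Real.sqrt 2 * (m / K m) ^ (-((1 : ℝ) / 4)) * (u x).im

/-- a₊(U;x). -/
def aP (K : ℝ → ℝ) (m : ℝ) (u : Fn d) : RFn d := fun x =>
  (1 / 2) * ((K (m + rhoU K m u x) - K m) / K m + rhoU K m u x / m)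
/-- a₋(U;x). -/
def aM (K : ℝ → ℝ) (m : ℝ) (u : Fn d) : RFn d := fun x =>
  (1 / 2) * ((K (m + rhoU K m u x) - K m) / K m - rhoU K m u x / m)
/-- λ(U;x) = √((𝚖+ρ)K(𝚖+ρ)/(𝚖K(𝚖))). -/
def lamU (K : ℝ → ℝ) (m : ℝ) (u : Fn d) : RFn d := fun x =>
  Real.sqrt ((m + rhoU K m u x) * K (m + rhoU K m u x) / (m * K m))

/-- Diagonal entry of A₂: √(𝚖K(𝚖))|ξ|²(1+a₊). -/
def A2diag (K : ℝ → ℝ) (m : ℝ) (u : Fn d) : Symb d := fun x ξ =>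
  ((Real.sqrt (m * K m) * normSq ξ * (1 + aP K m u x) : ℝ) : ℂ)
/-- Off-diagonal entry of A₂: √(𝚖K(𝚖))|ξ|² a₋. -/
def A2off (K : ℝ → ℝ) (m : ℝ) (u : Fn d) : Symb d := fun x ξ =>
  ((Real.sqrt (m * K m) * normSq ξ * aM K m u x : ℝ) : ℂ)
/-- A₁ entry: b(U;x)·ξ with b = ∇φ(U). -/
def A1sym (K : ℝ → ℝ) (m : ℝ) (u : Fn d) : Symb d := fun x ξ =>
  ((∑ i, pd i (phiU K m u) x * ξ i : ℝ) : ℂ)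

def conjF (u : Fn d) : Fn d := fun x => (starRingEnd ℂ) (u x)

/-- First component of 𝕁 Op^BW(A₂(w)+A₁(w)) applied to the pair (v, v̄). -/
def LinRHS (χ : Rd d → ℝ) (ε : ℝ) (K : ℝ → ℝ) (m : ℝ) (w v : Fn d) : Fn d := fun x =>
  -Complex.I * (OpBW χ ε (fun y ξ => A2diag K m w y ξ + A1sym K m w y ξ) v x
    + OpBW χ ε (A2off K m w) (conjF v) x)

/-- First component of the Euler–Korteweg vector field X written in the complex variable. -/
def XU1 (K g : ℝ → ℝ) (m : ℝ) (u : Fn d) : Fn d := fun x =>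
  (((1 / Real.sqrt 2) * (m / K m) ^ (-((1 : ℝ) / 4)) *
      EKmrho m (rhoU K m u) (phiU K m u) x : ℝ) : ℂ)
    + Complex.I * (((1 / Real.sqrt 2) * (m / K m) ^ ((1 : ℝ) / 4) *
      EKmphi K g m (rhoU K m u) (phiU K m u) x : ℝ) : ℂ)

/-- First component of the remainder R(U) := X(U) − 𝕁Op^BW(A₂(U)+A₁(U))U. -/
def RU (χ : Rd d → ℝ) (ε : ℝ) (K g : ℝ → ℝ) (m : ℝ) (u : Fn d) : Fn d := fun x =>
  XU1 K g m u x - LinRHS χ ε K m u u x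

/-- ρ(U) ∈ 𝒬. -/
def InQ (K : ℝ → ℝ) (m m1 m2 s0 : ℝ) (u : Fn d) : Prop :=
  InHsR s0 (rhoU K m u) ∧ ∀ x, m1 < m + rhoU K m u x ∧ m + rhoU K m u x < m2

/-- ρ(U) ∈ 𝒬_δ. -/
def InQd (K : ℝ → ℝ) (m m1 m2 s0 δ : ℝ) (u : Fn d) : Prop :=
  InHsR s0 (rhoU K m u) ∧ ∀ x, m1 + δ ≤ m + rhoU K m u x ∧ m + rhoU K m u x ≤ m2 - δ

/-- ‖U‖_s for U = (u,ū). -/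
def ubnorm (s : ℝ) (u : Fn d) : ℝ := Real.sqrt 2 * hnorm s u

/-- Membership of a pair W = (w,w̄) in Ḣ^s-bold. -/
def PairInH (s : ℝ) (P : Pair d) : Prop := InHdot s P.1 ∧ P.2 = conjF P.1
def bnorm (s : ℝ) (P : Pair d) : ℝ := Real.sqrt ((hnorm s P.1) ^ 2 + (hnorm s P.2) ^ 2)

/-- The matrix 𝕁 = diag(−i, i) acting on pairs. -/
def Jop (P : Pair d) : Pair d :=
  (fun x => -Complex.I * P.1 x, fun x => Complex.I * P.2 x)

/-- Matrix paradifferential operator. -/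
def MOpBW (χ : Rd d → ℝ) (ε : ℝ) (a11 a12 a21 a22 : Symb d) (P : Pair d) : Pair d :=
  (fun x => OpBW χ ε a11 P.1 x + OpBW χ ε a12 P.2 x,
   fun x => OpBW χ ε a21 P.1 x + OpBW χ ε a22 P.2 x)

/-- Scalar paradifferential operator acting diagonally on pairs. -/
def SOp (χ : Rd d → ℝ) (ε : ℝ) (a : Symb d) (P : Pair d) : Pair d :=
  (OpBW χ ε a P.1, OpBW χ ε a P.2)

def psub (P Q : Pair d) : Pair d := (fun x => P.1 x - Q.1 x, fun x => P.2 x - Q.2 x)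

/-- f entry of the diagonalizing matrix F. -/
def fF (K : ℝ → ℝ) (m : ℝ) (u : Fn d) : RFn d := fun x =>
  (1 + aP K m u x + lamU K m u x) /
    Real.sqrt ((1 + aP K m u x + lamU K m u x) ^ 2 - (aM K m u x) ^ 2)
/-- g entry of the diagonalizing matrix F. -/
def gF (K : ℝ → ℝ) (m : ℝ) (u : Fn d) : RFn d := fun x =>
  -(aM K m u x) / Real.sqrt ((1 + aP K m u x + lamU K m u x) ^ 2 - (aM K m u x) ^ 2)

/-- Op^BW(F). -/
def FmatOp (χ : Rd d → ℝ) (ε : ℝ) (K : ℝ → ℝ) (m : ℝ) (u : Fn d) (P : Pair d) : Pair d :=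
  MOpBW χ ε (fsymb (toC (fF K m u))) (fsymb (toC (gF K m u)))
    (fsymb (toC (gF K m u))) (fsymb (toC (fF K m u))) P
/-- Op^BW(F⁻¹). -/
def FinvOp (χ : Rd d → ℝ) (ε : ℝ) (K : ℝ → ℝ) (m : ℝ) (u : Fn d) (P : Pair d) : Pair d :=
  MOpBW χ ε (fsymb (toC (fF K m u))) (fsymb (toC fun x => -gF K m u x))
    (fsymb (toC fun x => -gF K m u x)) (fsymb (toC (fF K m u))) P

/-- Regularizing factor χ(ε̄ λ(U;x)|ξ|²). -/
def regFac (χ : Rd d → ℝ) (εb : ℝ) (K : ℝ → ℝ) (m : ℝ) (u : Fn d) : Symb d := fun x ξ =>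
  ((cut1 χ (εb * lamU K m u x * normSq ξ) : ℝ) : ℂ)

/-- The symbol λ^σ(U;x)|ξ|^{2σ}. -/
def lamSym (σ : ℝ) (K : ℝ → ℝ) (m : ℝ) (u : Fn d) : Symb d := fun x ξ =>
  (((lamU K m u x) ^ σ * (enorm ξ) ^ (2 * σ) : ℝ) : ℂ)

/-- The diagonal symbol (√(𝚖K(𝚖))λ|ξ|² + b·ξ)χ(ε̄λ|ξ|²). -/
def diagSym (χ : Rd d → ℝ) (εb : ℝ) (K : ℝ → ℝ) (m : ℝ) (u : Fn d) : Symb d := fun x ξ =>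
  (((Real.sqrt (m * K m) * lamU K m u x * normSq ξ + ∑ i, pd i (phiU K m u) x * ξ i) *
      cut1 χ (εb * lamU K m u x * normSq ξ) : ℝ) : ℂ)

/-- The matrix operator 𝕁 Op^BW(A^{ε̄}(U)). -/
def AepsOp (χ : Rd d → ℝ) (ε εb : ℝ) (K : ℝ → ℝ) (m : ℝ) (u : Fn d) (P : Pair d) : Pair d :=
  MOpBW χ ε
    (fun x ξ => (A2diag K m u x ξ + A1sym K m u x ξ) * regFac χ εb K m u x ξ)
    (fun x ξ => A2off K m u x ξ * regFac χ εb K m u x ξ)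
    (fun x ξ => A2off K m u x ξ * regFac χ εb K m u x ξ)
    (fun x ξ => (A2diag K m u x ξ - A1sym K m u x ξ) * regFac χ εb K m u x ξ) P

/-- First component of 𝕁 Op^BW(A^{ε̄}(w)) applied to (v, v̄). -/
def LinRHSreg (χ : Rd d → ℝ) (ε εb : ℝ) (K : ℝ → ℝ) (m : ℝ) (w v : Fn d) : Fn d := fun x =>
  -Complex.I *
    (OpBW χ ε (fun y ξ => (A2diag K m w y ξ + A1sym K m w y ξ) * regFac χ εb K m w y ξ) v x
      + OpBW χ ε (fun y ξ => A2off K m w y ξ * regFac χ εb K m w y ξ) (conjF v) x)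

/-- The operator ℱ(U) of the paradifferential diagonalization lemma. -/
def calF (χ : Rd d → ℝ) (ε εb : ℝ) (K : ℝ → ℝ) (m : ℝ) (u : Fn d) (W : Pair d) : Pair d :=
  psub (FinvOp χ ε K m u (Jop (AepsOp χ ε εb K m u (FmatOp χ ε K m u W))))
       (Jop (SOp χ ε (diagSym χ εb K m u) W))

/-- Real scalar product ⟨V,W⟩ = 2Re ∫ v w̄. -/
def rsp (P Q : Pair d) : ℝ :=
  2 * (∫ x in box d, P.1 x * (starRingEnd ℂ) (Q.1 x)).re

/-- Modified energy ‖V‖²_{σ,U}. -/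
def energy (χ : Rd d → ℝ) (ε σ : ℝ) (K : ℝ → ℝ) (m : ℝ) (u : Fn d) (V : Pair d) : ℝ :=
  rsp (SOp χ ε (lamSym σ K m u) (FinvOp χ ε K m u V)) (FinvOp χ ε K m u V)

/-- Fourier truncation Π_N to the modes 1 ≤ |j| ≤ N. -/
def truncN (N : ℕ) (u : Fn d) : Fn d := fun x =>
  ∑' j : Zd d, (if 1 ≤ znorm j ∧ znorm j ≤ (N : ℝ) then fcoef u j else 0) *
    Complex.exp (Complex.I * (dot (zR j) x : ℝ))

/-- Solution of the complex EK system ∂_t U = 𝕁Op^BW(A₂+A₁)U + R(U) (= X(U)) on [0,T],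
in C⁰Ḣ^s-bold ∩ C¹Ḣ^{s−2}-bold, represented by the first component u of U = (u,ū). -/
def SolEK (K g : ℝ → ℝ) (m s T : ℝ) (u : ℝ → Fn d) : Prop :=
  CCont (hnorm s) (InHdot s) (Set.Icc 0 T) u ∧
  CCont (hnorm (s - 2)) (InHdot (s - 2)) (Set.Icc 0 T) (fun t => XU1 K g m (u t)) ∧
  CDeriv (hnorm (s - 2)) (Set.Icc 0 T) u fun t => XU1 K g m (u t)

/-- Solution of the linear inhomogeneous paradifferential system
∂_t V = 𝕁Op^BW(A₂(U(t))+A₁(U(t)))V + R(t), V(0) = V₀,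
in C⁰Ḣ^σ-bold ∩ C¹Ḣ^{σ−2}-bold, represented by the first component. -/
def LinSol (χ : Rd d → ℝ) (ε : ℝ) (K : ℝ → ℝ) (m σ T : ℝ) (U : ℝ → Fn d)
    (Rc : ℝ → Fn d) (V0 : Fn d) (v : ℝ → Fn d) : Prop :=
  v 0 = V0 ∧
  CCont (hnorm σ) (InHdot σ) (Set.Icc 0 T) v ∧
  CCont (hnorm (σ - 2)) (InHdot (σ - 2)) (Set.Icc 0 T)
    (fun t => fun x => LinRHS χ ε K m (U t) (v t) x + Rc t x) ∧
  CDeriv (hnorm (σ - 2)) (Set.Icc 0 T) v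
    (fun t => fun x => LinRHS χ ε K m (U t) (v t) x + Rc t x)

/-- Solution of the regularized linear system ∂_t V = 𝕁Op^BW(A^{ε̄}(U(t)))V, V(0)=V₀,
smooth in time with values in every Ḣ^σ. -/
def RegSol (χ : Rd d → ℝ) (ε εb : ℝ) (K : ℝ → ℝ) (m T : ℝ) (U : ℝ → Fn d)
    (V0 : Fn d) (V : ℝ → Fn d) : Prop :=
  V 0 = V0 ∧ (∀ σ : ℝ, CCont (hnorm σ) (InHdot σ) (Set.Icc 0 T) V) ∧
  ∀ σ : ℝ, CDeriv (hnorm σ) (Set.Icc 0 T) V fun t => LinRHSreg χ ε εb K m (U t) (V t)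

end EK

namespace EK

open Filter Topology

/-- The character `x ↦ exp (i j · x)`. -/
def expChar {d : ℕ} (j : Zd d) (x : Rd d) : ℂ := Complex.exp (Complex.I * (dot (zR j) x : ℝ))

theorem norm_expChar {d : ℕ} (j : Zd d) (x : Rd d) : ‖expChar j x‖ = 1 := by
  rw [expChar, mul_comm, Complex.norm_exp_ofReal_mul_I]

theorem dot_zR_neg {d : ℕ} (j : Zd d) (x : Rd d) : dot (zR (-j)) x = -dot (zR j) x := by
  simp [dot, zR]

theorem dot_zR_add {d : ℕ} (j k : Zd d) (x : Rd d) :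
    dot (zR (j + k)) x = dot (zR j) x + dot (zR k) x := by
  simp [dot, zR, add_mul, Finset.sum_add_distrib]

theorem expChar_neg {d : ℕ} (j : Zd d) (x : Rd d) :
    expChar (-j) x = Complex.exp (-(Complex.I * (dot (zR j) x : ℝ))) := by
  rw [expChar, dot_zR_neg]
  push_cast
  ring_nf

theorem expChar_add {d : ℕ} (j k : Zd d) (x : Rd d) :
    expChar (j + k) x = expChar j x * expChar k x := by
  rw [expChar, expChar, expChar, dot_zR_add, ← Complex.exp_add]
  push_cast
  ring_nf

theorem continuous_expChar {d : ℕ} (j : Zd d) : Continuous (expChar j) := by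
  unfold expChar dot
  fun_prop

theorem expChar_eq_prod {d : ℕ} (j : Zd d) (x : Rd d) :
    expChar j x = ∏ i, Complex.exp (Complex.I * ((j i : ℝ) * x i : ℝ)) := by
  rw [expChar, ← Complex.exp_sum, dot, Complex.ofReal_sum, Finset.mul_sum]
  rfl

theorem expChar_periodic {d : ℕ} (n : Zd d) (x : Rd d) (j : Zd d) :
    expChar n (fun i => x i + 2 * Real.pi * (j i : ℝ)) = expChar n x := by
  rw [expChar_eq_prod, expChar_eq_prod]
  refine Finset.prod_congr rfl fun i _ => ?_
  rw [Complex.exp_eq_exp_iff_exists_int]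
  refine ⟨n i * j i, ?_⟩
  push_cast
  ring

theorem fcoef_eq {d : ℕ} (u : Fn d) (j : Zd d) :
    fcoef u j = (((2 * Real.pi) ^ d)⁻¹ : ℝ) • ∫ x in box d, u x * expChar (-j) x := by
  simp only [fcoef, expChar_neg]

theorem measurableSet_box (d : ℕ) : MeasurableSet (box d) :=
  MeasurableSet.univ_pi fun _ => measurableSet_Ioc

theorem box_subset_Icc (d : ℕ) :
    box d ⊆ Set.Icc (fun _ => (0 : ℝ)) (fun _ => 2 * Real.pi) := by
  intro x hx
  exact ⟨fun i => (hx i trivial).1.le, fun i => (hx i trivial).2⟩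

instance isFiniteMeasure_restrict_box (d : ℕ) :
    IsFiniteMeasure ((volume : Measure (Rd d)).restrict (box d)) := by
  refine ⟨?_⟩
  rw [Measure.restrict_apply_univ]
  exact (measure_mono (box_subset_Icc d)).trans_lt isCompact_Icc.measure_lt_top

theorem integrableOn_box {d : ℕ} {u : Fn d} (hu : LocallyIntegrable u volume) :
    IntegrableOn u (box d) volume :=
  (hu.integrableOn_isCompact isCompact_Icc).mono_set (box_subset_Icc d)

theorem integrableOn_box_mul_expChar {d : ℕ} {u : Fn d} (hu : IntegrableOn u (box d) volume)
    (j : Zd d) : IntegrableOn (fun x => u x * expChar j x) (box d) volume := by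
  refine hu.mul_bdd (c := 1) (continuous_expChar j).aestronglyMeasurable ?_
  exact ae_of_all _ fun x => (norm_expChar j x).le

/-- An integrable function on a compact metric space which integrates to zero against every
continuous function vanishes almost everywhere. -/
theorem ae_eq_zero_of_integral_continuousMap {T : Type*} [PseudoEMetricSpace T]
    [MeasurableSpace T] [BorelSpace T] {μ : Measure T} {w : T → ℂ} (hw : Integrable w μ)
    (h : ∀ g : C(T, ℂ), ∫ x, w x * g x ∂μ = 0) : w =ᵐ[μ] 0 := by
  refine ae_eq_zero_of_forall_setIntegral_isClosed_eq_zero hw fun s hs => ?_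
  have hpos : ∀ n : ℕ, (0 : ℝ) < 1 / ((n : ℝ) + 1) := fun n => by positivity
  have hlim := thickenedIndicator_tendsto_indicator_closure hpos
    tendsto_one_div_add_atTop_nhds_zero_nat s
  rw [hs.closure_eq, tendsto_pi_nhds] at hlim
  have key : Tendsto (fun n : ℕ => ∫ x, w x * ((thickenedIndicator (hpos n) s x : ℝ) : ℂ) ∂μ)
      atTop (𝓝 (∫ x, s.indicator w x ∂μ)) := by
    refine tendsto_integral_of_dominated_convergence (fun x => ‖w x‖) ?_ hw.norm ?_ ?_
    · intro n
      refine hw.aestronglyMeasurable.mul ?_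
      exact (Complex.continuous_ofReal.comp (NNReal.continuous_coe.comp
        (thickenedIndicator (hpos n) s).continuous)).aestronglyMeasurable
    · intro n
      refine ae_of_all _ fun x => ?_
      rw [norm_mul, Complex.norm_real, NNReal.norm_eq]
      exact mul_le_of_le_one_right (norm_nonneg _)
        (by exact_mod_cast thickenedIndicator_le_one (hpos n) s x)
    · refine ae_of_all _ fun x => ?_
      have h1 : Tendsto (fun n : ℕ => ((thickenedIndicator (hpos n) s x : ℝ) : ℂ)) atTop
          (𝓝 (((s.indicator (fun _ => (1 : NNReal)) x : NNReal) : ℝ) : ℂ)) :=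
        (Complex.continuous_ofReal.tendsto _).comp
          ((NNReal.continuous_coe.tendsto _).comp (hlim x))
      have h2 := h1.const_mul (w x)
      convert h2 using 2
      by_cases hx : x ∈ s <;> simp [hx]
  rw [← integral_indicator hs.measurableSet]
  refine tendsto_nhds_unique key ?_
  have hz : ∀ n : ℕ, ∫ x, w x * ((thickenedIndicator (hpos n) s x : ℝ) : ℂ) ∂μ = 0 := fun n =>
    h ⟨fun x => ((thickenedIndicator (hpos n) s x : ℝ) : ℂ),
      Complex.continuous_ofReal.comp (NNReal.continuous_coe.comp
        (thickenedIndicator (hpos n) s).continuous)⟩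
  simp only [hz]
  exact tendsto_const_nhds

/-- The projection `ℝ^d → 𝕋^d` with period `2π` in each variable. -/
def toTorus {d : ℕ} (x : Rd d) : UnitAddTorus (Fin d) := fun i => ((x i / (2 * Real.pi) : ℝ) : UnitAddCircle)

/-- The representative in `box d` of a point of the torus. -/
def torusRep {d : ℕ} (θ : UnitAddTorus (Fin d)) : Rd d :=
  fun i => 2 * Real.pi * (AddCircle.measurableEquivIoc (1 : ℝ) 0 (θ i) : ℝ)

theorem continuous_toTorus {d : ℕ} : Continuous (toTorus (d := d)) := by
  refine continuous_pi fun i => ?_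
  exact (AddCircle.continuous_mk' (1 : ℝ)).comp ((continuous_apply i).div_const _)

theorem measurable_torusRep {d : ℕ} : Measurable (torusRep (d := d)) := by
  refine measurable_pi_lambda _ fun i => ?_
  exact (measurable_subtype_coe.comp ((AddCircle.measurableEquivIoc (1 : ℝ) 0).measurable.comp
    (measurable_pi_apply i))).const_mul _

theorem torusRep_toTorus {d : ℕ} {x : Rd d} (hx : x ∈ box d) : torusRep (toTorus x) = x := by
  funext i
  have hp : (0 : ℝ) < 2 * Real.pi := by positivity
  have h1 := hx i trivial
  have hmem : x i / (2 * Real.pi) ∈ Set.Ioc (0 : ℝ) (0 + 1) :=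
    ⟨div_pos h1.1 hp, by rw [zero_add]; exact (div_le_one hp).2 h1.2⟩
  have : (AddCircle.measurableEquivIoc (1 : ℝ) 0 (toTorus x i) : ℝ) = x i / (2 * Real.pi) :=
    AddCircle.equivIoc_coe_of_mem (p := (1 : ℝ)) hmem
  rw [torusRep, this]
  field_simp

theorem mFourier_toTorus {d : ℕ} (n : Zd d) (x : Rd d) :
    UnitAddTorus.mFourier n (toTorus x) = expChar n x := by
  rw [expChar_eq_prod]
  change ∏ i, fourier (n i) (toTorus x i) = _
  refine Finset.prod_congr rfl fun i _ => ?_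
  rw [toTorus, fourier_coe_apply]
  congr 1
  have : (Real.pi : ℂ) ≠ 0 := by exact_mod_cast Real.pi_ne_zero
  push_cast
  field_simp

/-- Uniqueness of Fourier coefficients for integrable functions. -/
theorem ae_eq_zero_of_integral_expChar {d : ℕ} {w : Fn d} (hw : IntegrableOn w (box d) volume)
    (h : ∀ n : Zd d, ∫ x in box d, w x * expChar n x = 0) :
    w =ᵐ[volume.restrict (box d)] 0 := by
  set ν := (volume : Measure (Rd d)).restrict (box d) with hν
  have hint : ∀ g : C(UnitAddTorus (Fin d), ℂ), Integrable (fun x => w x * g (toTorus x)) ν := by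
    intro g
    refine hw.mul_bdd (c := ‖g‖) (g.continuous.comp continuous_toTorus).aestronglyMeasurable ?_
    exact ae_of_all _ fun x => g.norm_coe_le_norm _
  have hzero : ∀ g : C(UnitAddTorus (Fin d), ℂ), ∫ x, w x * g (toTorus x) ∂ν = 0 := by
    let V : Submodule ℂ C(UnitAddTorus (Fin d), ℂ) :=
      { carrier := {g | ∫ x, w x * g (toTorus x) ∂ν = 0}
        add_mem' := by
          intro a b ha hb
          simp only [Set.mem_ofPred_eq, ContinuousMap.add_apply, mul_add] at *
          rw [integral_add (hint a) (hint b), ha, hb, add_zero]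
        zero_mem' := by simp
        smul_mem' := by
          intro c a ha
          simp only [Set.mem_ofPred_eq, ContinuousMap.smul_apply, smul_eq_mul] at *
          simp only [mul_left_comm _ c]
          rw [integral_const_mul, ha, mul_zero] }
    have hclosed : IsClosed (V : Set C(UnitAddTorus (Fin d), ℂ)) := by
      have hc : Continuous fun g : C(UnitAddTorus (Fin d), ℂ) =>
          ∫ x, w x * g (toTorus x) ∂ν := by
        rw [continuous_iff_continuousAt]
        intro g
        refine continuousAt_of_dominated (bound := fun x => ‖w x‖ * (‖g‖ + 1))
          (Eventually.of_forall fun g => (hint g).aestronglyMeasurable) ?_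
          (hw.norm.mul_const _) ?_
        · filter_upwards [Metric.ball_mem_nhds g one_pos] with g' hg'
          refine ae_of_all _ fun x => ?_
          rw [norm_mul]
          refine mul_le_mul_of_nonneg_left ((g'.norm_coe_le_norm _).trans ?_) (norm_nonneg _)
          rw [mem_ball_iff_norm] at hg'
          linarith [norm_le_norm_add_norm_sub' g' g]
        · refine ae_of_all _ fun x => ?_
          exact (continuous_const.mul (continuous_eval_const (toTorus x))).continuousAt
      exact isClosed_eq hc continuous_const
    have hle : Submodule.span ℂ (Set.range (UnitAddTorus.mFourier (d := Fin d))) ≤ V := by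
      rw [Submodule.span_le]
      rintro _ ⟨n, rfl⟩
      change ∫ x, w x * UnitAddTorus.mFourier n (toTorus x) ∂ν = 0
      simp only [mFourier_toTorus]
      exact h n
    have htop := Submodule.topologicalClosure_minimal _ hle hclosed
    rw [UnitAddTorus.span_mFourier_closure_eq_top] at htop
    intro g
    exact htop (Submodule.mem_top : g ∈ ⊤)
  obtain ⟨w', hw'm, hww'⟩ := hw.aestronglyMeasurable
  have hmemb : ∀ᵐ x ∂ν, x ∈ box d := ae_restrict_mem (measurableSet_box d)
  have hrep : ∀ᵐ x ∂ν, w x = w' (torusRep (toTorus x)) := by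
    filter_upwards [hww', hmemb] with x hx hx'
    rw [torusRep_toTorus hx', hx]
  have hWm : AEStronglyMeasurable (fun θ => w' (torusRep θ)) (ν.map (toTorus (d := d))) :=
    (hw'm.comp_measurable measurable_torusRep).aestronglyMeasurable
  have hmeas : AEMeasurable (toTorus (d := d)) ν := continuous_toTorus.measurable.aemeasurable
  have hW : (fun θ => w' (torusRep θ)) =ᵐ[ν.map (toTorus (d := d))] 0 := by
    refine ae_eq_zero_of_integral_continuousMap ?_ ?_
    · rw [integrable_map_measure hWm hmeas]
      exact hw.congr hrep
    · intro g
      have hgm := hWm.mul (g.continuous.aestronglyMeasurable (μ := ν.map (toTorus (d := d))))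
      refine (integral_map hmeas hgm).trans ?_
      rw [← hzero g]
      refine integral_congr_ae ?_
      filter_upwards [hrep] with x hx
      rw [hx]
      rfl
  have := ae_of_ae_map hmeas hW
  filter_upwards [this, hrep] with x hx hx'
  rw [hx', hx]
  rfl

theorem integral_box_expChar {d : ℕ} (j : Zd d) :
    ∫ x in box d, expChar j x = if j = 0 then (((2 * Real.pi) ^ d : ℝ) : ℂ) else 0 := by
  have h1 : ∫ x in box d, expChar j x = ∏ i : Fin d,
      ∫ t in Set.Ioc (0 : ℝ) (2 * Real.pi), Complex.exp (Complex.I * ((j i : ℝ) * t : ℝ)) := by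
    rw [← integral_fintype_prod_eq_prod, ← Measure.restrict_pi_pi]
    exact integral_congr_ae (ae_of_all _ fun x => expChar_eq_prod j x)
  have hp : (0 : ℝ) ≤ 2 * Real.pi := by positivity
  rw [h1]
  split_ifs with hj
  · subst hj
    simp [hp]
  · obtain ⟨i, hi⟩ := Function.ne_iff.1 hj
    refine Finset.prod_eq_zero (Finset.mem_univ i) ?_
    rw [← intervalIntegral.integral_of_le hp]
    have hne : Complex.I * (j i : ℂ) ≠ 0 :=
      mul_ne_zero Complex.I_ne_zero (by exact_mod_cast hi)
    have h2 : ∀ t : ℝ, Complex.exp (Complex.I * ((j i : ℝ) * t : ℝ)) =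
        Complex.exp (Complex.I * (j i : ℂ) * t) := fun t => by push_cast; ring_nf
    simp only [h2]
    rw [integral_exp_mul_complex hne]
    have h3 : Complex.exp (Complex.I * (j i : ℂ) * ((2 * Real.pi : ℝ) : ℂ)) = 1 := by
      rw [Complex.exp_eq_one_iff]
      exact ⟨j i, by push_cast; ring⟩
    rw [h3]
    simp

theorem continuous_tsum_expChar {d : ℕ} {c : Zd d → ℂ} (hc : Summable fun j => ‖c j‖) :
    Continuous fun x => ∑' j, c j * expChar j x := by
  refine continuous_tsum (fun j => continuous_const.mul (continuous_expChar j)) hc fun j x => ?_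
  rw [norm_mul, norm_expChar, mul_one]

/-- Fourier coefficients of an absolutely convergent trigonometric series. -/
theorem fcoef_tsum_expChar {d : ℕ} {c : Zd d → ℂ} (hc : Summable fun j => ‖c j‖) (n : Zd d) :
    fcoef (fun x => ∑' j, c j * expChar j x) n = c n := by
  have hp : ((2 * Real.pi) ^ d : ℝ) ≠ 0 := by positivity
  have hint : ∀ j : Zd d, Integrable (fun x => c j * expChar (j - n) x)
      ((volume : Measure (Rd d)).restrict (box d)) := fun j =>
    (Integrable.of_bound (continuous_expChar _).aestronglyMeasurable 1
      (ae_of_all _ fun x => (norm_expChar _ x).le)).const_mul _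
  rw [fcoef_eq]
  have h1 : ∀ x : Rd d, (∑' j, c j * expChar j x) * expChar (-n) x =
      ∑' j, c j * expChar (j - n) x := by
    intro x
    rw [← tsum_mul_right]
    refine tsum_congr fun j => ?_
    rw [sub_eq_add_neg, expChar_add, mul_assoc]
  simp only [h1]
  rw [← integral_tsum_of_summable_integral_norm hint]
  · simp only [integral_const_mul, integral_box_expChar, sub_eq_zero]
    rw [tsum_eq_single n fun j hj => by simp [hj]]
    simp only [if_true, Complex.real_smul]
    rw [mul_left_comm, ← Complex.ofReal_mul, inv_mul_cancel₀ hp]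
    simp
  · simp only [norm_mul, norm_expChar, mul_one]
    simp only [integral_const, smul_eq_mul]
    exact hc.mul_left _

/-- A locally integrable function with absolutely summable Fourier coefficients is bounded by
the sum of their moduli. -/
theorem ae_norm_le_tsum_fcoef {d : ℕ} {v : Fn d} (hv : IntegrableOn v (box d) volume)
    (hs : Summable fun j => ‖fcoef v j‖) :
    ∀ᵐ x ∂(volume.restrict (box d)), ‖v x‖ ≤ ∑' j, ‖fcoef v j‖ := by
  have hp : ((2 * Real.pi) ^ d : ℝ)⁻¹ ≠ 0 := by positivity
  set f : Fn d := fun x => ∑' j, fcoef v j * expChar j x with hf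
  have hterm : ∀ x, ∀ j, ‖fcoef v j * expChar j x‖ = ‖fcoef v j‖ := fun x j => by
    rw [norm_mul, norm_expChar, mul_one]
  have hfb : ∀ x, ‖f x‖ ≤ ∑' j, ‖fcoef v j‖ := by
    intro x
    have := norm_tsum_le_tsum_norm (f := fun j => fcoef v j * expChar j x)
      (by simpa only [hterm] using hs)
    simpa only [hterm] using this
  have hfi : IntegrableOn f (box d) volume :=
    Integrable.of_bound (continuous_tsum_expChar hs).aestronglyMeasurable _ (ae_of_all _ hfb)
  have hz : (fun x => v x - f x) =ᵐ[volume.restrict (box d)] 0 := by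
    refine ae_eq_zero_of_integral_expChar (hv.sub hfi) fun n => ?_
    have h1 := fcoef_eq v (-n)
    have h2 := fcoef_eq f (-n)
    rw [hf, fcoef_tsum_expChar hs, ← hf, h1] at h2
    rw [neg_neg] at h2
    have h3 := smul_right_injective ℂ hp h2
    simp only [sub_mul]
    rw [integral_sub (integrableOn_box_mul_expChar hv n) (integrableOn_box_mul_expChar hfi n)]
    exact sub_eq_zero.2 h3
  filter_upwards [hz] with x hx
  have : v x = f x := sub_eq_zero.1 hx
  rw [this]
  exact hfb x

theorem enorm_eq_norm {d : ℕ} (x : Rd d) : enorm x = ‖WithLp.toLp 2 x‖ := by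
  simp [enorm, EuclideanSpace.norm_eq]

theorem enorm_nonneg {d : ℕ} (x : Rd d) : 0 ≤ enorm x := Real.sqrt_nonneg _

theorem znorm_nonneg {d : ℕ} (j : Zd d) : 0 ≤ znorm j := enorm_nonneg _

theorem enorm_add_le {d : ℕ} (x y : Rd d) : enorm (x + y) ≤ enorm x + enorm y := by
  simpa only [enorm_eq_norm, WithLp.toLp_add] using norm_add_le (WithLp.toLp 2 x) (WithLp.toLp 2 y)

theorem enorm_smul {d : ℕ} (c : ℝ) (x : Rd d) : enorm (c • x) = |c| * enorm x := by
  simp only [enorm_eq_norm, WithLp.toLp_smul, norm_smul, Real.norm_eq_abs]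

theorem abs_apply_le_enorm {d : ℕ} (x : Rd d) (i : Fin d) : |x i| ≤ enorm x := by
  rw [enorm_eq_norm, ← Real.norm_eq_abs]
  exact PiLp.norm_apply_le (WithLp.toLp 2 x) i

theorem enorm_le_mul_of_abs_le {d : ℕ} {x : Rd d} {r : ℝ} (hr : 0 ≤ r) (h : ∀ i, |x i| ≤ r) :
    enorm x ≤ d * r := by
  rw [enorm, Real.sqrt_le_left (by positivity)]
  calc ∑ i, x i ^ 2 ≤ ∑ _i : Fin d, r ^ 2 :=
        Finset.sum_le_sum fun i _ => sq_le_sq' (abs_le.1 (h i)).1 (abs_le.1 (h i)).2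
    _ = d * r ^ 2 := by simp
    _ ≤ (d * r) ^ 2 := by
        rw [mul_pow]
        refine mul_le_mul_of_nonneg_right ?_ (by positivity)
        rcases Nat.eq_zero_or_pos d with h0 | h0
        · simp [h0]
        · exact le_self_pow₀ (by exact_mod_cast h0) two_ne_zero

theorem continuous_enorm {d : ℕ} : Continuous (enorm (d := d)) := by
  unfold enorm
  fun_prop

theorem continuous_jap {d : ℕ} : Continuous (jap (d := d)) :=
  continuous_const.max continuous_enorm

theorem one_le_jap {d : ℕ} (ξ : Rd d) : 1 ≤ jap ξ := le_max_left _ _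

theorem jap_pos {d : ℕ} (ξ : Rd d) : 0 < jap ξ := one_pos.trans_le (one_le_jap ξ)

theorem japZ_pos {d : ℕ} (j : Zd d) : 0 < japZ j := jap_pos _

theorem one_le_znorm {d : ℕ} {j : Zd d} (hj : j ≠ 0) : 1 ≤ znorm j := by
  obtain ⟨i, hi⟩ := Function.ne_iff.1 hj
  refine le_trans ?_ (abs_apply_le_enorm (zR j) i)
  have : (1 : ℤ) ≤ |j i| := Int.one_le_abs hi
  simp only [zR]
  exact_mod_cast this

theorem japZ_le_znorm {d : ℕ} {j n : Zd d} (hj : j ≠ 0) (h : znorm n ≤ znorm j) :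
    japZ n ≤ znorm j :=
  max_le (one_le_znorm hj) h

theorem summable_japZ_rpow {d : ℕ} {s : ℝ} (hs : (d : ℝ) / 2 < s) :
    Summable fun j : Zd d => (japZ j) ^ (-(2 * s)) := by
  set b := Pi.basisFun ℝ (Fin d)
  set L := Submodule.span ℤ (Set.range b) with hL
  have hrank : Module.finrank ℤ L = d := by
    rw [ZLattice.rank ℝ L]
    simp
  have hsum : Summable fun z : L => ‖z‖ ^ (-(2 * s)) :=
    ZLattice.summable_norm_rpow L _ (by rw [hrank]; linarith)
  have hmem : ∀ j : Zd d, zR j ∈ L := fun j => by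
    rw [hL, Module.Basis.mem_span_iff_repr_mem]
    intro i
    exact ⟨j i, by simp [b, zR]⟩
  have hinj : Function.Injective fun j : Zd d => (⟨zR j, hmem j⟩ : L) := by
    intro j k hjk
    have h : zR j = zR k := congrArg Subtype.val hjk
    funext i
    have hi : ((j i : ℤ) : ℝ) = (k i : ℤ) := congrFun h i
    exact_mod_cast hi
  have h0 := hsum.comp_injective hinj
  have h1 : Summable fun j : Zd d => if j = 0 then (1 : ℝ) else 0 :=
    (hasSum_ite_eq (0 : Zd d) (1 : ℝ)).summable
  refine Summable.of_nonneg_of_le (fun j => (Real.rpow_pos_of_pos (japZ_pos j) _).le) ?_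
    (h0.add h1)
  intro j
  have hd : (0 : ℝ) ≤ d := Nat.cast_nonneg d
  rcases eq_or_ne j 0 with rfl | hj
  · have : japZ (0 : Zd d) = 1 := by simp [japZ, jap, zR, enorm]
    rw [this, Real.one_rpow, if_pos rfl]
    have : 0 ≤ ((fun z : L => ‖z‖ ^ (-(2 * s))) ∘ fun j : Zd d => (⟨zR j, hmem j⟩ : L)) 0 :=
      Real.rpow_nonneg (norm_nonneg _) _
    linarith
  · rw [if_neg hj, add_zero]
    refine Real.rpow_le_rpow_of_nonpos ?_ ?_ (by linarith)
    · rw [norm_pos_iff]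
      intro h
      apply hj
      apply hinj
      have h0 : zR (0 : Zd d) = 0 := by
        funext i
        simp [zR]
      exact Subtype.ext ((congrArg Subtype.val h).trans h0.symm)
    · refine le_trans ?_ (le_max_right _ _)
      exact (pi_norm_le_iff_of_nonneg (enorm_nonneg _)).2 fun i => abs_apply_le_enorm (zR j) i

theorem sobNorm_nonneg {d : ℕ} (s : ℝ) (u : Fn d) : 0 ≤ sobNorm s u := Real.sqrt_nonneg _

theorem sum_le_sobNorm_sq {d : ℕ} {s : ℝ} {v : Fn d}
    (hv : Summable fun j : Zd d => (japZ j) ^ (2 * s) * ‖fcoef v j‖ ^ 2) (N : Finset (Zd d)) :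
    ∑ j ∈ N, (japZ j) ^ (2 * s) * ‖fcoef v j‖ ^ 2 ≤ sobNorm s v ^ 2 := by
  have hnn : ∀ j : Zd d, 0 ≤ (japZ j) ^ (2 * s) * ‖fcoef v j‖ ^ 2 := fun j =>
    mul_nonneg (Real.rpow_nonneg (japZ_pos j).le _) (by positivity)
  rw [sobNorm, sobSq, Real.sq_sqrt (tsum_nonneg hnn)]
  exact hv.sum_le_tsum N fun j _ => hnn j

/-- Cauchy–Schwarz in the form used for the embedding `H^s ⊂ ℓ¹`. -/
theorem sum_mul_le_sqrt {ι : Type*} (N : Finset ι) (w : ι → ℝ) (hw : ∀ n, 0 < w n) (p q : ℝ)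
    (f : ι → ℝ) {Z K : ℝ} (hZ : ∑ n ∈ N, w n ^ (-(2 * p)) ≤ Z)
    (hK : ∑ n ∈ N, w n ^ (2 * (p + q)) * f n ^ 2 ≤ K) :
    ∑ n ∈ N, w n ^ q * f n ≤ Real.sqrt (Z * K) := by
  refine Real.le_sqrt_of_sq_le ?_
  have hnn : ∀ n, 0 ≤ w n ^ (-(2 * p)) := fun n => (Real.rpow_pos_of_pos (hw n) _).le
  refine (Finset.sum_sq_le_sum_mul_sum_of_sq_le_mul N (fun n _ => hnn n)
    (g := fun n => w n ^ (2 * (p + q)) * f n ^ 2)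
    (fun n _ => mul_nonneg (Real.rpow_pos_of_pos (hw n) _).le (sq_nonneg _)) ?_).trans ?_
  · intro n _
    refine le_of_eq ?_
    rw [mul_pow, ← mul_assoc, ← Real.rpow_add (hw n), ← Real.rpow_natCast, ← Real.rpow_mul (hw n).le]
    congr 2
    push_cast
    ring
  · refine mul_le_mul hZ hK (Finset.sum_nonneg fun n _ =>
      mul_nonneg (Real.rpow_pos_of_pos (hw n) _).le (sq_nonneg _)) ?_
    exact (Finset.sum_nonneg fun n _ => hnn n).trans hZ

/-- The constant of the embedding `H^s ⊂ L^∞`. -/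
def embConst (d : ℕ) (s : ℝ) : ℝ := ∑' j : Zd d, (japZ j) ^ (-(2 * s))

theorem embConst_nonneg (d : ℕ) (s : ℝ) : 0 ≤ embConst d s :=
  tsum_nonneg fun j => (Real.rpow_pos_of_pos (japZ_pos j) _).le

theorem sum_le_embConst {d : ℕ} {s : ℝ} (hs : (d : ℝ) / 2 < s) (N : Finset (Zd d)) :
    ∑ j ∈ N, (japZ j) ^ (-(2 * s)) ≤ embConst d s :=
  (summable_japZ_rpow hs).sum_le_tsum N fun j _ => (Real.rpow_pos_of_pos (japZ_pos j) _).le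

/-- The embedding `H^s ⊂ L^∞` for `s > d/2`. -/
theorem InHs.ae_norm_le {d : ℕ} {s : ℝ} (hs : (d : ℝ) / 2 < s) {v : Fn d} (hv : InHs s v) :
    ∀ᵐ x ∂(volume.restrict (box d)), ‖v x‖ ≤ Real.sqrt (embConst d s) * sobNorm s v := by
  have hfin : ∀ N : Finset (Zd d),
      ∑ j ∈ N, ‖fcoef v j‖ ≤ Real.sqrt (embConst d s) * sobNorm s v := by
    intro N
    have h := sum_mul_le_sqrt N japZ japZ_pos s 0 (fun j => ‖fcoef v j‖) (sum_le_embConst hs N)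
      (by simpa only [add_zero] using sum_le_sobNorm_sq hv.2.2 N)
    rw [Real.sqrt_mul (embConst_nonneg d s), Real.sqrt_sq (sobNorm_nonneg s v)] at h
    simpa using h
  have hsum : Summable fun j => ‖fcoef v j‖ := summable_of_sum_le (fun j => norm_nonneg _) hfin
  filter_upwards [ae_norm_le_tsum_fcoef (integrableOn_box hv.2.1) hsum] with x hx
  exact hx.trans (hsum.tsum_le_of_sum_le hfin)

theorem pd_eq_fderiv {d : ℕ} {f : Rd d → ℂ} (hf : Differentiable ℝ f) (i : Fin d) (x : Rd d) :
    pd i f x = fderiv ℝ f x (Pi.single i 1) := by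
  have h1 : HasDerivAt (fun t : ℝ => f (Function.update x i t))
      (fderiv ℝ f (Function.update x i (x i)) (Pi.single i 1)) (x i) :=
    (hf _).hasFDerivAt.comp_hasDerivAt (x i) (hasDerivAt_update x i (x i))
  rw [Function.update_eq_self] at h1
  exact h1.deriv

theorem hasDerivAt_comp_update {d : ℕ} {f : Rd d → ℂ} (hf : Differentiable ℝ f) (i : Fin d)
    (x : Rd d) (t : ℝ) :
    HasDerivAt (fun t : ℝ => f (Function.update x i t)) (pd i f (Function.update x i t)) t := by
  rw [pd_eq_fderiv hf]
  exact (hf _).hasFDerivAt.comp_hasDerivAt t (hasDerivAt_update x i t)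

theorem contDiff_pd {d : ℕ} {f : Rd d → ℂ} (hf : ContDiff ℝ (⊤ : ℕ∞) f) (i : Fin d) :
    ContDiff ℝ (⊤ : ℕ∞) (pd i f) := by
  have h : pd i f = fun x => fderiv ℝ f x (Pi.single i 1) :=
    funext fun x => pd_eq_fderiv (hf.differentiable (by simp)) i x
  rw [h]
  exact (hf.fderiv_right (m := (⊤ : ℕ∞)) (by simp)).clm_apply contDiff_const

theorem contDiff_pdM {d : ℕ} {f : Rd d → ℂ} (hf : ContDiff ℝ (⊤ : ℕ∞) f) (β : Fin d → ℕ) :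
    ContDiff ℝ (⊤ : ℕ∞) (pdM β f) := by
  unfold pdM
  induction List.finRange d with
  | nil => exact hf
  | cons i L ih =>
    rw [List.foldr_cons]
    induction β i with
    | zero => exact ih
    | succ n ihn =>
      rw [Function.iterate_succ_apply']
      exact contDiff_pd ihn i

/-- The multi-index which is the indicator of a set of coordinates. -/
def indMulti {d : ℕ} (S : Finset (Fin d)) : Fin d → ℕ := fun i => if i ∈ S then 1 else 0

theorem mOrder_indMulti {d : ℕ} (S : Finset (Fin d)) : mOrder (indMulti S) = S.card := by
  simp [mOrder, indMulti]

theorem pdM_indMulti_insert {d : ℕ} (f : Rd d → ℂ) (p : Fin d) (S : Finset (Fin d))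
    (hS : ∀ i ∈ S, p < i) :
    pdM (indMulti (insert p S)) f = pd p (pdM (indMulti S) f) := by
  have key : ∀ L : List (Fin d), L.Pairwise (· < ·) → p ∈ L →
      L.foldr (fun i g => (pd i)^[indMulti (insert p S) i] g) f =
        pd p (L.foldr (fun i g => (pd i)^[indMulti S i] g) f) := by
    intro L
    induction L with
    | nil => simp
    | cons h T ih =>
      intro hL hp
      rw [List.pairwise_cons] at hL
      rw [List.foldr_cons, List.foldr_cons]
      have hnot : ∀ i ≤ p, i ∉ S := fun i hi hiS => absurd (hS i hiS) (not_lt.2 hi)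
      rcases eq_or_ne h p with rfl | hne
      · have hT : T.foldr (fun i g => (pd i)^[indMulti (insert h S) i] g) f =
            T.foldr (fun i g => (pd i)^[indMulti S i] g) f := by
          refine List.foldr_ext _ _ _ fun i hi g => ?_
          have : i ≠ h := (hL.1 i hi).ne'
          simp [indMulti, this]
        rw [hT]
        simp [indMulti, hnot h le_rfl]
      · have hpT : p ∈ T := by
          rcases List.mem_cons.1 hp with h1 | h1
          · exact absurd h1.symm hne
          · exact h1
        have hlt : h < p := hL.1 p hpT
        rw [ih hL.2 hpT]
        simp [indMulti, hnot h hlt.le, hne]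
  exact key _ (List.pairwise_lt_finRange d) (List.mem_finRange p)

theorem SymbH.ae_sdxi_le {d : ℕ} {s m : ℝ} (hs : (d : ℝ) / 2 < s) {a : Symb d} (ha : SymbH s m a)
    (β : Fin d → ℕ) : ∃ C : ℝ, ∀ᵐ x ∂(volume.restrict (box d)), ∀ ξ : Rd d,
      ‖sdxi β a x ξ‖ ≤ C * jap ξ ^ (m - (mOrder β : ℝ)) := by
  obtain ⟨C, hC⟩ := ha.bound β
  refine ⟨Real.sqrt (embConst d s) * C, ?_⟩
  have h1 : ∀ᵐ x ∂(volume.restrict (box d)), ∀ k : ℕ,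
      ‖sdxi β a x (TopologicalSpace.denseSeq (Rd d) k)‖ ≤ Real.sqrt (embConst d s) * C *
        jap (TopologicalSpace.denseSeq (Rd d) k) ^ (m - (mOrder β : ℝ)) := by
    rw [ae_all_iff]
    intro k
    filter_upwards [(ha.mem β (TopologicalSpace.denseSeq (Rd d) k)).ae_norm_le hs] with x hx
    rw [mul_assoc]
    exact hx.trans (mul_le_mul_of_nonneg_left (hC _) (Real.sqrt_nonneg _))
  filter_upwards [h1] with x hx ξ
  have hcl : IsClosed {ξ : Rd d | ‖sdxi β a x ξ‖ ≤ Real.sqrt (embConst d s) * C *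
      jap ξ ^ (m - (mOrder β : ℝ))} := by
    refine isClosed_le (contDiff_pdM (ha.smooth x) β).continuous.norm ?_
    exact continuous_const.mul (continuous_jap.rpow_const fun ξ => Or.inl (jap_pos ξ).ne')
  have hsub := hcl.closure_subset_iff.2 (Set.range_subset_iff.2 hx)
  rw [(TopologicalSpace.denseRange_denseSeq (Rd d)).closure_range] at hsub
  exact hsub (Set.mem_univ ξ)

theorem SymbH.aestronglyMeasurable_mul_expChar {d : ℕ} {s m : ℝ} {a : Symb d} (ha : SymbH s m a)
    (β : Fin d → ℕ) (ξ : Rd d) (n : Zd d) :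
    AEStronglyMeasurable (fun x => sdxi β a x ξ * expChar n x) (volume.restrict (box d)) :=
  (integrableOn_box_mul_expChar (integrableOn_box (ha.mem β ξ).2.1) n).aestronglyMeasurable

theorem exists_eventually_jap_rpow_le {d : ℕ} (p C : ℝ) (ξ : Rd d) :
    ∃ M : ℝ, ∀ᶠ η in 𝓝 ξ, C * jap η ^ p ≤ M := by
  have hc : Continuous fun η : Rd d => C * jap η ^ p :=
    continuous_const.mul (continuous_jap.rpow_const fun ξ => Or.inl (jap_pos ξ).ne')
  exact ⟨C * jap ξ ^ p + 1, (hc.tendsto ξ).eventually_le_const (by linarith)⟩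

theorem SymbH.continuous_scoef {d : ℕ} {s m : ℝ} (hs : (d : ℝ) / 2 < s) {a : Symb d}
    (ha : SymbH s m a) (β : Fin d → ℕ) (n : Zd d) : Continuous (scoef (sdxi β a) n) := by
  have h : scoef (sdxi β a) n = fun ξ => (((2 * Real.pi) ^ d)⁻¹ : ℝ) •
      ∫ x in box d, sdxi β a x ξ * expChar (-n) x := funext fun ξ => fcoef_eq _ _
  rw [h]
  suffices hc : Continuous fun ξ => ∫ x in box d, sdxi β a x ξ * expChar (-n) x from
    hc.const_smul (((2 * Real.pi) ^ d)⁻¹ : ℝ)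
  rw [continuous_iff_continuousAt]
  intro ξ
  obtain ⟨C, hC⟩ := ha.ae_sdxi_le hs β
  obtain ⟨M, hM⟩ := exists_eventually_jap_rpow_le (m - (mOrder β : ℝ)) C ξ
  refine continuousAt_of_dominated (bound := fun _ => M) (Eventually.of_forall fun η =>
    ha.aestronglyMeasurable_mul_expChar β η (-n)) ?_ (integrable_const _) ?_
  · filter_upwards [hM] with η hη
    filter_upwards [hC] with x hx
    rw [norm_mul, norm_expChar, mul_one]
    exact (hx η).trans hη
  · refine ae_of_all _ fun x => ?_
    exact ((contDiff_pdM (ha.smooth x) β).continuous.mul continuous_const).continuousAt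

theorem SymbH.hasDerivAt_scoef {d : ℕ} {s m : ℝ} (hs : (d : ℝ) / 2 < s) {a : Symb d}
    (ha : SymbH s m a) (p : Fin d) (S : Finset (Fin d)) (hS : ∀ i ∈ S, p < i) (n : Zd d)
    (ξ : Rd d) (t : ℝ) :
    HasDerivAt (fun t : ℝ => scoef (sdxi (indMulti S) a) n (Function.update ξ p t))
      (scoef (sdxi (indMulti (insert p S)) a) n (Function.update ξ p t)) t := by
  have h : ∀ β : Fin d → ℕ, ∀ η, scoef (sdxi β a) n η = (((2 * Real.pi) ^ d)⁻¹ : ℝ) •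
      ∫ x in box d, sdxi β a x η * expChar (-n) x := fun β η => fcoef_eq _ _
  simp only [h]
  suffices hd : HasDerivAt (fun t : ℝ => ∫ x in box d,
        sdxi (indMulti S) a x (Function.update ξ p t) * expChar (-n) x)
      (∫ x in box d, sdxi (indMulti (insert p S)) a x (Function.update ξ p t) * expChar (-n) x) t
    from hd.const_smul (((2 * Real.pi) ^ d)⁻¹ : ℝ)
  obtain ⟨C, hC⟩ := ha.ae_sdxi_le hs (indMulti (insert p S))
  obtain ⟨M, hM⟩ := exists_eventually_jap_rpow_le (m - (mOrder (indMulti (insert p S)) : ℝ)) C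
    (Function.update ξ p t)
  have hcont : Continuous fun t : ℝ => Function.update ξ p t :=
    continuous_const.update p continuous_id
  refine (hasDerivAt_integral_of_dominated_loc_of_deriv_le (bound := fun _ => M)
    (F' := fun τ x => sdxi (indMulti (insert p S)) a x (Function.update ξ p τ) * expChar (-n) x)
    ((hcont.tendsto t).eventually hM) (Eventually.of_forall fun τ =>
      ha.aestronglyMeasurable_mul_expChar _ _ _)
    (integrableOn_box_mul_expChar (integrableOn_box (ha.mem _ _).2.1) _)
    (ha.aestronglyMeasurable_mul_expChar _ _ _) ?_ (integrable_const _) ?_).2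
  · filter_upwards [hC] with x hx τ hτ
    rw [norm_mul, norm_expChar, mul_one]
    exact (hx _).trans hτ
  · refine ae_of_all _ fun x τ _ => HasDerivAt.mul_const ?_ _
    simp only [sdxi, pdM_indMulti_insert _ p S hS]
    exact hasDerivAt_comp_update
      ((contDiff_pdM (ha.smooth x) (indMulti S)).differentiable (by simp)) p ξ τ

/-- One-dimensional Sobolev inequality on an interval of half-length `r`. -/
theorem norm_sq_le_integral {f f' : ℝ → ℂ} (hf : ∀ t, HasDerivAt f (f' t) t)
    (hf' : Continuous f') {c r t : ℝ} (hr : 0 < r) (ht : t ∈ Set.Icc (c - r) (c + r)) :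
    2 * r * ‖f t‖ ^ 2 ≤
      ∫ τ in (c - r)..(c + r), (2 * ‖f τ‖ ^ 2 + 8 * r ^ 2 * ‖f' τ‖ ^ 2) := by
  have hcf : Continuous f := continuous_iff_continuousAt.2 fun t => (hf t).continuousAt
  have hle : c - r ≤ c + r := by linarith
  have hint : ∀ g : ℝ → ℝ, Continuous g → IntervalIntegrable g volume (c - r) (c + r) :=
    fun g hg => hg.intervalIntegrable _ _
  set J := ∫ τ in (c - r)..(c + r), ‖f' τ‖ with hJ
  set Q := ∫ τ in (c - r)..(c + r), ‖f' τ‖ ^ 2 with hQ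
  have hJQ : J ^ 2 ≤ 2 * r * Q := by
    have h0 : 0 ≤ ∫ τ in (c - r)..(c + r), (‖f' τ‖ - J / (2 * r)) ^ 2 :=
      intervalIntegral.integral_nonneg hle fun τ _ => sq_nonneg _
    have h1 : ∫ τ in (c - r)..(c + r), (‖f' τ‖ - J / (2 * r)) ^ 2 =
        Q - (J / r) * J + 2 * r * (J / (2 * r)) ^ 2 := by
      have : ∀ τ, (‖f' τ‖ - J / (2 * r)) ^ 2 =
          ‖f' τ‖ ^ 2 - (J / r) * ‖f' τ‖ + (J / (2 * r)) ^ 2 := fun τ => by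
        field_simp
        ring
      simp only [this]
      rw [intervalIntegral.integral_add (hint _ (by fun_prop)) (hint _ (by fun_prop)),
        intervalIntegral.integral_sub (hint _ (by fun_prop)) (hint _ (by fun_prop)),
        intervalIntegral.integral_const_mul, intervalIntegral.integral_const, smul_eq_mul]
      ring
    rw [h1] at h0
    have h2 : Q - (J / r) * J + 2 * r * (J / (2 * r)) ^ 2 = (2 * r * Q - J ^ 2) / (2 * r) := by
      field_simp
      ring
    rw [h2, le_div_iff₀ (by positivity)] at h0
    linarith
  have hpt : ∀ τ ∈ Set.Icc (c - r) (c + r), ‖f t‖ ^ 2 ≤ 2 * ‖f τ‖ ^ 2 + 2 * J ^ 2 := by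
    intro τ hτ
    have h1 : ∫ y in τ..t, f' y = f t - f τ :=
      intervalIntegral.integral_eq_sub_of_hasDerivAt (fun y _ => hf y)
        (hf'.intervalIntegrable _ _)
    have h2 : ‖f t - f τ‖ ≤ J := by
      rw [← h1]
      refine (intervalIntegral.norm_integral_le_abs_integral_norm).trans ?_
      have h3 := intervalIntegral.abs_integral_mono_interval (μ := volume)
        (f := fun y => ‖f' y‖) (a := τ) (b := t) (c := c - r) (d := c + r)
        (Set.uIoc_subset_uIoc_of_uIcc_subset_uIcc (Set.uIcc_subset_uIcc
          (by rwa [Set.uIcc_of_le hle]) (by rwa [Set.uIcc_of_le hle])))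
        (ae_of_all _ fun y => norm_nonneg _) (hint _ hf'.norm)
      rwa [abs_of_nonneg (intervalIntegral.integral_nonneg hle fun y _ => norm_nonneg (f' y))] at h3
    have h3 : ‖f t‖ ≤ ‖f τ‖ + J := by
      have := norm_le_norm_add_norm_sub' (f t) (f τ)
      linarith
    nlinarith [norm_nonneg (f t), norm_nonneg (f τ), sq_nonneg (‖f τ‖ - J)]
  have h4 : ∫ _τ in (c - r)..(c + r), ‖f t‖ ^ 2 ≤
      ∫ τ in (c - r)..(c + r), (2 * ‖f τ‖ ^ 2 + 2 * J ^ 2) :=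
    intervalIntegral.integral_mono_on hle (hint _ (by fun_prop)) (hint _ (by fun_prop)) hpt
  rw [intervalIntegral.integral_const, smul_eq_mul,
    intervalIntegral.integral_add (hint _ (by fun_prop)) (hint _ (by fun_prop)),
    intervalIntegral.integral_const, smul_eq_mul] at h4
  rw [intervalIntegral.integral_add (hint _ (by fun_prop)) (hint _ (by fun_prop)),
    intervalIntegral.integral_const_mul (8 * r ^ 2)]
  nlinarith [mul_le_mul_of_nonneg_left hJQ hr.le]

theorem sum_norm_sq_le_of_hasDerivAt {ι : Type*} (N : Finset ι) {w : ι → ℝ} (hw : ∀ n, 0 ≤ w n)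
    {g g' : ι → ℝ → ℂ} (hg : ∀ n t, HasDerivAt (g n) (g' n t) t) (hg' : ∀ n, Continuous (g' n))
    {c r K : ℝ} (hr : 0 < r)
    (h : ∀ τ ∈ Set.Icc (c - r) (c + r), ∑ n ∈ N, w n * ‖g n τ‖ ^ 2 ≤ K)
    (h' : ∀ τ ∈ Set.Icc (c - r) (c + r), ∑ n ∈ N, w n * r ^ 2 * ‖g' n τ‖ ^ 2 ≤ K)
    {t : ι → ℝ} (ht : ∀ n, t n ∈ Set.Icc (c - r) (c + r)) :
    ∑ n ∈ N, w n * ‖g n (t n)‖ ^ 2 ≤ 10 * K := by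
  have hle : c - r ≤ c + r := by linarith
  have hcg : ∀ n, Continuous (g n) := fun n =>
    continuous_iff_continuousAt.2 fun t => (hg n t).continuousAt
  have h1 : 2 * r * ∑ n ∈ N, w n * ‖g n (t n)‖ ^ 2 ≤
      ∫ τ in (c - r)..(c + r), ∑ n ∈ N, w n * (2 * ‖g n τ‖ ^ 2 + 8 * r ^ 2 * ‖g' n τ‖ ^ 2) := by
    rw [intervalIntegral.integral_finsetSum fun n _ =>
      Continuous.intervalIntegrable (by have := hcg n; have := hg' n; fun_prop) _ _,
      Finset.mul_sum]
    refine Finset.sum_le_sum fun n _ => ?_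
    rw [intervalIntegral.integral_const_mul]
    calc 2 * r * (w n * ‖g n (t n)‖ ^ 2) = w n * (2 * r * ‖g n (t n)‖ ^ 2) := by ring
      _ ≤ _ := mul_le_mul_of_nonneg_left (norm_sq_le_integral (hg n) (hg' n) hr (ht n)) (hw n)
  have h2 : ∫ τ in (c - r)..(c + r),
      ∑ n ∈ N, w n * (2 * ‖g n τ‖ ^ 2 + 8 * r ^ 2 * ‖g' n τ‖ ^ 2) ≤
      ∫ _τ in (c - r)..(c + r), 10 * K := by
    refine intervalIntegral.integral_mono_on hle (Continuous.intervalIntegrable ?_ _ _)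
      (by simp) fun τ hτ => ?_
    · exact continuous_finsetSum _ fun n _ => by have := hcg n; have := hg' n; fun_prop
    · have e : ∑ n ∈ N, w n * (2 * ‖g n τ‖ ^ 2 + 8 * r ^ 2 * ‖g' n τ‖ ^ 2) =
          2 * ∑ n ∈ N, w n * ‖g n τ‖ ^ 2 + 8 * ∑ n ∈ N, w n * r ^ 2 * ‖g' n τ‖ ^ 2 := by
        rw [Finset.mul_sum, Finset.mul_sum, ← Finset.sum_add_distrib]
        exact Finset.sum_congr rfl fun n _ => by ring
      rw [e]
      linarith [h τ hτ, h' τ hτ]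
  rw [intervalIntegral.integral_const, smul_eq_mul] at h2
  have h3 := h1.trans h2
  have h4 : (c + r - (c - r)) * (10 * K) = 2 * r * (10 * K) := by ring
  rw [h4] at h3
  exact le_of_mul_le_mul_left h3 (by positivity)

/-- Passing from a common frequency to frequencies depending on the index, at the price of one
derivative in each direction. -/
theorem sum_norm_sq_le_of_cube {d : ℕ} {ι : Type*} (N : Finset ι) {w : ι → ℝ}
    (hw : ∀ n, 0 ≤ w n) {F : Finset (Fin d) → ι → Rd d → ℂ}
    (hF : ∀ (p : Fin d) (S : Finset (Fin d)), (∀ i ∈ S, p < i) → ∀ n ξ t,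
      HasDerivAt (fun t : ℝ => F S n (Function.update ξ p t))
        (F (insert p S) n (Function.update ξ p t)) t)
    (hFc : ∀ S n, Continuous (F S n)) {c : Rd d} {r K : ℝ} (hr : 0 < r)
    (hK : ∀ S, ∀ ξ : Rd d, (∀ i, ξ i ∈ Set.Icc (c i - r) (c i + r)) →
      ∑ n ∈ N, w n * r ^ (2 * S.card) * ‖F S n ξ‖ ^ 2 ≤ K)
    {ξ : ι → Rd d} (hξ : ∀ n i, ξ n i ∈ Set.Icc (c i - r) (c i + r)) :
    ∑ n ∈ N, w n * ‖F ∅ n (ξ n)‖ ^ 2 ≤ 10 ^ d * K := by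
  have key : ∀ p : ℕ, p ≤ d → ∀ S : Finset (Fin d), (∀ i ∈ S, p ≤ (i : ℕ)) →
      ∀ ξ : ι → Rd d, (∀ n i, ξ n i ∈ Set.Icc (c i - r) (c i + r)) →
      (∀ n n' (i : Fin d), p ≤ (i : ℕ) → ξ n i = ξ n' i) →
      ∑ n ∈ N, w n * r ^ (2 * S.card) * ‖F S n (ξ n)‖ ^ 2 ≤ 10 ^ p * K := by
    intro p
    induction p with
    | zero =>
      intro _ S _ ξ hξ hagree
      rw [pow_zero, one_mul]
      rcases N.eq_empty_or_nonempty with rfl | ⟨n₀, _⟩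
      · simpa using hK S c fun i => ⟨by linarith, by linarith⟩
      · have : ∀ n, ξ n = ξ n₀ := fun n => funext fun i => hagree n n₀ i (Nat.zero_le _)
        simp only [this]
        exact hK S _ (hξ n₀)
    | succ p ih =>
      intro hp S hS ξ hξ hagree
      have hpd : p < d := hp
      set P : Fin d := ⟨p, hpd⟩ with hP
      have hPS : ∀ i ∈ S, P < i := fun i hi => hS i hi
      have hnot : P ∉ S := fun h => lt_irrefl _ (hPS P h)
      have hQ : ∀ τ ∈ Set.Icc (c P - r) (c P + r), ∀ n i,
          Function.update (ξ n) P τ i ∈ Set.Icc (c i - r) (c i + r) := by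
        intro τ hτ n i
        rcases eq_or_ne i P with rfl | hi
        · simpa using hτ
        · simpa [hi] using hξ n i
      have hA : ∀ τ : ℝ, ∀ n n' (i : Fin d), p ≤ (i : ℕ) →
          Function.update (ξ n) P τ i = Function.update (ξ n') P τ i := by
        intro τ n n' i hi
        rcases eq_or_ne i P with rfl | hne
        · simp
        · have : p ≠ (i : ℕ) := fun h => hne (Fin.ext h.symm)
          simpa [hne] using hagree n n' i (by omega)
      have h := sum_norm_sq_le_of_hasDerivAt N (w := fun n => w n * r ^ (2 * S.card))
        (fun n => mul_nonneg (hw n) (by positivity))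
        (g := fun n t => F S n (Function.update (ξ n) P t))
        (g' := fun n t => F (insert P S) n (Function.update (ξ n) P t))
        (fun n t => hF P S hPS n (ξ n) t)
        (fun n => (hFc _ n).comp (continuous_const.update P continuous_id))
        hr
        (fun τ hτ => ih hpd.le S (fun i hi => (Nat.le_succ p).trans (hS i hi)) _ (hQ τ hτ) (hA τ))
        (fun τ hτ => by
          have := ih hpd.le (insert P S) (fun i hi => by
            rcases Finset.mem_insert.1 hi with rfl | hi
            · exact le_rfl
            · exact (Nat.le_succ p).trans (hS i hi)) _ (hQ τ hτ) (hA τ)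
          rw [Finset.card_insert_of_notMem hnot] at this
          refine le_trans (le_of_eq ?_) this
          exact Finset.sum_congr rfl fun n _ => by ring)
        (fun n => hξ n P)
      simp only [Function.update_eq_self] at h
      refine h.trans (le_of_eq ?_)
      ring
  have h := key d le_rfl ∅ (by simp) ξ hξ fun n n' i hi => absurd i.2 (not_lt.2 hi)
  simpa using h

theorem rpow_le_two_rpow_abs_mul {x y : ℝ} (hy : 0 < y) (h1 : y / 2 ≤ x) (h2 : x ≤ 2 * y)
    (q : ℝ) : x ^ q ≤ 2 ^ |q| * y ^ q := by
  have hx : 0 < x := by linarith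
  rcases le_total 0 q with hq | hq
  · rw [abs_of_nonneg hq, ← Real.mul_rpow two_pos.le hy.le]
    exact Real.rpow_le_rpow hx.le h2 hq
  · rw [abs_of_nonpos hq]
    calc x ^ q ≤ (2⁻¹ * y) ^ q := Real.rpow_le_rpow_of_nonpos (by positivity) (by linarith) hq
      _ = 2 ^ (-q) * y ^ q := by
        rw [Real.mul_rpow (by positivity) hy.le, Real.inv_rpow two_pos.le, Real.rpow_neg two_pos.le]

theorem summable_sob_of_le {d : ℕ} {s σ : ℝ} (hσ : σ ≤ s) {v : Fn d}
    (hv : Summable fun j : Zd d => (japZ j) ^ (2 * s) * ‖fcoef v j‖ ^ 2) :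
    Summable fun j : Zd d => (japZ j) ^ (2 * σ) * ‖fcoef v j‖ ^ 2 := by
  refine Summable.of_nonneg_of_le
    (fun j => mul_nonneg (Real.rpow_nonneg (japZ_pos j).le _) (by positivity)) (fun j => ?_) hv
  exact mul_le_mul_of_nonneg_right
    (Real.rpow_le_rpow_of_exponent_le (one_le_jap _) (by linarith)) (by positivity)

theorem sobNorm_le_of_le {d : ℕ} {s σ : ℝ} (hσ : σ ≤ s) {v : Fn d}
    (hv : Summable fun j : Zd d => (japZ j) ^ (2 * s) * ‖fcoef v j‖ ^ 2) :
    sobNorm σ v ≤ sobNorm s v := by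
  refine Real.sqrt_le_sqrt ((summable_sob_of_le hσ hv).tsum_le_tsum (fun j => ?_) hv)
  exact mul_le_mul_of_nonneg_right
    (Real.rpow_le_rpow_of_exponent_le (one_le_jap _) (by linarith)) (by positivity)

theorem snormH_nonneg {d : ℕ} (s m : ℝ) (n : ℕ) (a : Symb d) : 0 ≤ snormH s m n a :=
  Real.iSup_nonneg fun _ => Real.iSup_nonneg fun ξ =>
    mul_nonneg (Real.rpow_nonneg (jap_pos ξ).le _) (sobNorm_nonneg _ _)

theorem finite_mOrder_le (d n : ℕ) : Finite {β : Fin d → ℕ // mOrder β ≤ n} := by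
  refine Set.Finite.to_subtype ((Set.finite_Icc (0 : Fin d → ℕ) fun _ => n).subset fun β hβ => ?_)
  exact ⟨fun i => Nat.zero_le _, fun i =>
    (Finset.single_le_sum (f := β) (fun _ _ => Nat.zero_le _) (Finset.mem_univ i)).trans hβ⟩

theorem SymbH.sobNorm_le {d : ℕ} {s σ m : ℝ} (hσ : σ ≤ s) {a : Symb d} (ha : SymbH s m a) {n : ℕ}
    {β : Fin d → ℕ} (hβ : mOrder β ≤ n) (ξ : Rd d) :
    sobNorm σ (fun x => sdxi β a x ξ) ≤ snormH σ m n a * jap ξ ^ (m - (mOrder β : ℝ)) := by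
  have := finite_mOrder_le d n
  have hbdd : BddAbove (Set.range fun ξ : Rd d =>
      (jap ξ) ^ (-m + (mOrder β : ℝ)) * sobNorm σ fun x => sdxi β a x ξ) := by
    obtain ⟨C, hC⟩ := ha.bound β
    refine ⟨C, ?_⟩
    rintro _ ⟨ξ, rfl⟩
    have h1 := (sobNorm_le_of_le hσ (ha.mem β ξ).2.2).trans (hC ξ)
    calc (jap ξ) ^ (-m + (mOrder β : ℝ)) * sobNorm σ (fun x => sdxi β a x ξ)
        ≤ (jap ξ) ^ (-m + (mOrder β : ℝ)) * (C * jap ξ ^ (m - (mOrder β : ℝ))) :=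
          mul_le_mul_of_nonneg_left h1 (Real.rpow_nonneg (jap_pos ξ).le _)
      _ = C * (jap ξ ^ (-m + (mOrder β : ℝ)) * jap ξ ^ (m - (mOrder β : ℝ))) := by ring
      _ = C := by
        rw [← Real.rpow_add (jap_pos ξ)]
        simp
  have h1 : (jap ξ) ^ (-m + (mOrder β : ℝ)) * sobNorm σ (fun x => sdxi β a x ξ) ≤
      snormH σ m n a :=
    (le_ciSup hbdd ξ).trans (le_ciSup (f := fun β : {β : Fin d → ℕ // mOrder β ≤ n} =>
      ⨆ ξ : Rd d, (jap ξ) ^ (-m + (mOrder β.1 : ℝ)) * sobNorm σ fun x => sdxi β.1 a x ξ)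
      (Set.finite_range _).bddAbove ⟨β, hβ⟩)
  calc sobNorm σ (fun x => sdxi β a x ξ)
      = (jap ξ ^ (-m + (mOrder β : ℝ)) * sobNorm σ (fun x => sdxi β a x ξ)) *
          jap ξ ^ (m - (mOrder β : ℝ)) := by
        have : jap ξ ^ (-m + (mOrder β : ℝ)) * jap ξ ^ (m - (mOrder β : ℝ)) = 1 := by
          rw [← Real.rpow_add (jap_pos ξ)]
          simp
        rw [mul_right_comm, this, one_mul]
    _ ≤ _ := mul_le_mul_of_nonneg_right h1 (Real.rpow_nonneg (jap_pos ξ).le _)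

theorem sdxi_indMulti_empty {d : ℕ} (a : Symb d) : sdxi (indMulti ∅) a = a := by
  funext x ξ
  simp only [sdxi, pdM]
  suffices h : ∀ L : List (Fin d),
      L.foldr (fun i g => (pd i)^[indMulti ∅ i] g) (a x) = a x by
    rw [h]
  intro L
  induction L with
  | nil => rfl
  | cons i L ih => simp [indMulti]

theorem jap_mem_of_close {d : ℕ} {p : Zd d} (hp : p ≠ 0) {ξ : Rd d}
    (h : enorm (ξ - zR p) ≤ znorm p / 2) : znorm p / 2 ≤ jap ξ ∧ jap ξ ≤ 2 * znorm p := by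
  have h1 : enorm ξ ≤ enorm (ξ - zR p) + enorm (zR p) := by
    simpa using enorm_add_le (ξ - zR p) (zR p)
  have h2 : enorm (zR p) ≤ enorm ξ + enorm (ξ - zR p) := by
    have := enorm_add_le ξ ((-1 : ℝ) • (ξ - zR p))
    rw [enorm_smul] at this
    simpa using this
  have h3 : enorm (zR p) = znorm p := rfl
  have h4 := one_le_znorm hp
  exact ⟨le_trans (by linarith) (le_max_right _ _), max_le (by linarith) (by linarith)⟩

/-- The constant in the `ℓ¹` bound for Fourier coefficients at nearby frequencies. -/
def nearConst (d : ℕ) (m s : ℝ) : ℝ := Real.sqrt (embConst d s * 10 ^ d) * 2 ^ |m|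

theorem nearConst_nonneg (d : ℕ) (m s : ℝ) : 0 ≤ nearConst d m s := by
  unfold nearConst
  positivity

theorem SymbH.sum_norm_scoef_le {d : ℕ} {s m ϱ : ℝ} (hs : (d : ℝ) / 2 < s) (hϱ : 0 ≤ ϱ)
    {a : Symb d} (ha : SymbH s m a) {p : Zd d} (hp : p ≠ 0) (N : Finset (Zd d))
    {ξ : Zd d → Rd d} (hξ : ∀ n i, |ξ n i - p i| ≤ znorm p / (2 * (d + 1))) :
    ∑ n ∈ N, japZ n ^ (-ϱ) * ‖scoef a n (ξ n)‖ ≤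
      nearConst d m s * snormH (s - ϱ) m (2 * (d + 1)) a * znorm p ^ m := by
  set A := snormH (s - ϱ) m (2 * (d + 1)) a with hA
  have hA0 : 0 ≤ A := snormH_nonneg _ _ _ _
  set P := znorm p with hP
  have hP1 : 1 ≤ P := one_le_znorm hp
  have hP0 : 0 < P := by linarith
  set r := P / (2 * (d + 1)) with hr
  have hr0 : 0 < r := by positivity
  have hdr : d * r ≤ P / 2 := by
    rw [hr, mul_div_assoc', div_le_div_iff₀ (by positivity) two_pos]
    nlinarith
  have hrP : r ≤ P / 2 := by
    rw [hr]
    refine div_le_div_of_nonneg_left hP0.le two_pos ?_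
    have : (0 : ℝ) ≤ d := Nat.cast_nonneg d
    linarith
  set K := (A * (2 ^ |m| * P ^ m)) ^ 2 with hK
  have hsq : ∑ n ∈ N, japZ n ^ (2 * (s - ϱ)) * ‖scoef (sdxi (indMulti ∅) a) n (ξ n)‖ ^ 2 ≤
      10 ^ d * K := by
    refine sum_norm_sq_le_of_cube (c := zR p) (r := r) N
      (fun n => Real.rpow_nonneg (japZ_pos n).le _)
      (F := fun S n => scoef (sdxi (indMulti S) a) n)
      (fun q S hS n ξ t => ha.hasDerivAt_scoef hs q S hS n ξ t)
      (fun S n => ha.continuous_scoef hs _ n) hr0 ?_ ?_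
    · intro S η hη
      have hη' : ∀ i, |(η - zR p) i| ≤ r := fun i => by
        rw [abs_le, Pi.sub_apply]
        exact ⟨by linarith [(hη i).1], by linarith [(hη i).2]⟩
      obtain ⟨hj1, hj2⟩ := jap_mem_of_close hp ((enorm_le_mul_of_abs_le hr0.le hη').trans hdr)
      have hord : mOrder (indMulti S) ≤ 2 * (d + 1) := by
        rw [mOrder_indMulti]
        have := S.card_le_univ
        rw [Fintype.card_fin] at this
        omega
      have h1 := ha.sobNorm_le (σ := s - ϱ) (by linarith) hord η
      rw [mOrder_indMulti] at h1
      have h2 : r ^ S.card * sobNorm (s - ϱ) (fun x => sdxi (indMulti S) a x η) ≤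
          A * (2 ^ |m| * P ^ m) := by
        have hj0 := jap_pos η
        calc r ^ S.card * sobNorm (s - ϱ) (fun x => sdxi (indMulti S) a x η)
            ≤ jap η ^ S.card * (A * jap η ^ (m - (S.card : ℝ))) :=
              mul_le_mul (pow_le_pow_left₀ hr0.le (hrP.trans hj1) _) h1 (sobNorm_nonneg _ _)
                (by positivity)
          _ = A * jap η ^ m := by
              rw [Real.rpow_sub hj0, Real.rpow_natCast]
              field_simp
          _ ≤ _ := mul_le_mul_of_nonneg_left (rpow_le_two_rpow_abs_mul hP0 hj1 hj2 m) hA0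
      calc ∑ n ∈ N, japZ n ^ (2 * (s - ϱ)) * r ^ (2 * S.card) *
            ‖scoef (sdxi (indMulti S) a) n η‖ ^ 2
          = r ^ (2 * S.card) * ∑ n ∈ N, japZ n ^ (2 * (s - ϱ)) *
              ‖fcoef (fun x => sdxi (indMulti S) a x η) n‖ ^ 2 := by
            rw [Finset.mul_sum]
            exact Finset.sum_congr rfl fun n _ => by
              simp only [scoef]
              ring
        _ ≤ r ^ (2 * S.card) * sobNorm (s - ϱ) (fun x => sdxi (indMulti S) a x η) ^ 2 :=
            mul_le_mul_of_nonneg_left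
              (sum_le_sobNorm_sq (summable_sob_of_le (by linarith) (ha.mem _ η).2.2) N)
              (by positivity)
        _ = (r ^ S.card * sobNorm (s - ϱ) (fun x => sdxi (indMulti S) a x η)) ^ 2 := by ring
        _ ≤ K := pow_le_pow_left₀ (mul_nonneg (by positivity) (sobNorm_nonneg _ _)) h2 2
    · intro n i
      have := abs_le.1 (hξ n i)
      simp only [zR]
      exact ⟨by linarith, by linarith⟩
  rw [sdxi_indMulti_empty] at hsq
  have h := sum_mul_le_sqrt N japZ japZ_pos s (-ϱ) (fun n => ‖scoef a n (ξ n)‖)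
    (sum_le_embConst hs N) (by simpa only [sub_eq_add_neg] using hsq)
  refine h.trans (le_of_eq ?_)
  rw [← mul_assoc, Real.sqrt_mul (mul_nonneg (embConst_nonneg d s) (by positivity)), hK,
    Real.sqrt_sq (by positivity), nearConst]
  ring

theorem finite_znorm_le (d : ℕ) (R : ℝ) : {n : Zd d | znorm n ≤ R}.Finite := by
  refine (Set.finite_Icc (fun _ : Fin d => -⌈R⌉) fun _ => ⌈R⌉).subset fun n hn => ?_
  have h : ∀ i, |(n i : ℝ)| ≤ ⌈R⌉ := fun i =>
    ((abs_apply_le_enorm (zR n) i).trans hn).trans (Int.le_ceil R)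
  have h' : ∀ i, |n i| ≤ ⌈R⌉ := fun i => by exact_mod_cast h i
  exact ⟨fun i => (abs_le.1 (h' i)).1, fun i => (abs_le.1 (h' i)).2⟩

theorem IsCutoff.znorm_lt {d : ℕ} {χ : Rd d → ℝ} (hχ : IsCutoff χ) {ε : ℝ} (hε : 0 < ε) {n : Zd d}
    {ξ : Rd d} (h : χ (fun i => (n i : ℝ) / (ε * jap ξ)) ≠ 0) : znorm n < 1.9 * ε * jap ξ := by
  by_contra! hcon
  refine h (hχ.eq_zero _ ?_)
  have hpos : 0 < ε * jap ξ := mul_pos hε (jap_pos ξ)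
  have e : (fun i => (n i : ℝ) / (ε * jap ξ)) = (ε * jap ξ)⁻¹ • zR n := by
    funext i
    simp only [zR, Pi.smul_apply, smul_eq_mul]
    ring
  rw [e, enorm_smul, abs_of_pos (inv_pos.2 hpos), inv_mul_eq_div, le_div_iff₀ hpos]
  have : enorm (zR n) = znorm n := rfl
  linarith

theorem scoef_achi {d : ℕ} {χ : Rd d → ℝ} (hχ : IsCutoff χ) {ε : ℝ} (hε : 0 < ε) (a : Symb d)
    (n : Zd d) (ξ : Rd d) :
    scoef (achi χ ε a) n ξ = (χ (fun i => (n i : ℝ) / (ε * jap ξ)) : ℂ) * scoef a n ξ := by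
  refine fcoef_tsum_expChar
    (c := fun j : Zd d => (χ (fun i => (j i : ℝ) / (ε * jap ξ)) : ℂ) * scoef a j ξ) ?_ n
  refine summable_of_hasFiniteSupport ((finite_znorm_le d (1.9 * ε * jap ξ)).subset fun j hj => ?_)
  refine (hχ.znorm_lt hε fun h0 => hj ?_).le
  simp [h0]

theorem norm_scoef_achi_le {d : ℕ} {χ : Rd d → ℝ} (hχ : IsCutoff χ) {ε : ℝ} (hε : 0 < ε)
    (a : Symb d) (n : Zd d) (ξ : Rd d) : ‖scoef (achi χ ε a) n ξ‖ ≤ ‖scoef a n ξ‖ := by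
  rw [scoef_achi hχ hε, norm_mul, Complex.norm_real, Real.norm_eq_abs,
    abs_of_nonneg (hχ.mem01 _).1]
  exact mul_le_of_le_one_left (norm_nonneg _) (hχ.mem01 _).2

theorem znorm_sub_comm {d : ℕ} (j k : Zd d) : znorm (j - k) = znorm (k - j) := by
  simp only [znorm, enorm, zR, Pi.sub_apply, Int.cast_sub]
  congr 1
  exact Finset.sum_congr rfl fun i _ => by ring

theorem znorm_le_add {d : ℕ} (j k : Zd d) : znorm k ≤ znorm j + znorm (j - k) := by
  have h := enorm_add_le (zR j) (zR (k - j))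
  have e : zR j + zR (k - j) = zR k := by
    funext i
    simp [zR]
  rw [e] at h
  rw [znorm_sub_comm]
  exact h

/-- Frequencies interacting in a Bony–Weyl operator are comparable. -/
theorem znorm_near {d : ℕ} {j k : Zd d} (hj : j ≠ 0)
    (h : znorm (j - k) ≤ 1 / (4 * (d + 1)) * jap fun i => ((j i : ℝ) + (k i : ℝ)) / 2) :
    znorm (j - k) ≤ znorm j / (d + 1) ∧ znorm j / 2 ≤ znorm k ∧ znorm k ≤ 2 * znorm j := by
  have hJ := one_le_znorm hj
  have h1 : (jap fun i => ((j i : ℝ) + (k i : ℝ)) / 2) ≤ znorm j + znorm (j - k) := by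
    refine max_le (by linarith [znorm_nonneg (j - k)]) ?_
    have e : (fun i => ((j i : ℝ) + (k i : ℝ)) / 2) = zR j + (-(1 / 2 : ℝ)) • zR (j - k) := by
      funext i
      simp only [zR, Pi.add_apply, Pi.smul_apply, smul_eq_mul, Pi.sub_apply, Int.cast_sub]
      ring
    rw [e]
    refine (enorm_add_le _ _).trans ?_
    rw [enorm_smul, abs_neg, abs_of_pos one_half_pos]
    have e1 : enorm (zR j) = znorm j := rfl
    have e2 : enorm (zR (j - k)) = znorm (j - k) := rfl
    linarith [znorm_nonneg (j - k)]
  have hd : (0 : ℝ) ≤ d := Nat.cast_nonneg d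
  have h2 : znorm (j - k) * (4 * (d + 1)) ≤ znorm j + znorm (j - k) := by
    have h3 := h.trans (mul_le_mul_of_nonneg_left h1 (by positivity))
    rwa [one_div, inv_mul_eq_div, le_div_iff₀ (by positivity)] at h3
  have h4 := znorm_nonneg (j - k)
  have h5 : znorm (j - k) * (d + 1) ≤ znorm j := by nlinarith [mul_nonneg h4 hd]
  have h6 : znorm (j - k) ≤ znorm j / 2 := by nlinarith [mul_nonneg h4 hd]
  have h7 := znorm_le_add j k
  have h8 := znorm_le_add k j
  rw [znorm_sub_comm k j] at h8
  refine ⟨by rwa [le_div_iff₀ (by positivity)], by linarith, by linarith⟩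

theorem sum_sq_le_of_schur {ι κ : Type*} (J : Finset ι) (L : Finset κ) {B : ι → κ → ℝ}
    (hB : ∀ j k, 0 ≤ B j k) (v : κ → ℝ) {R C : ℝ} (hR : 0 ≤ R)
    (hrow : ∀ j ∈ J, ∑ k ∈ L, B j k ≤ R) (hcol : ∀ k ∈ L, ∑ j ∈ J, B j k ≤ C) :
    ∑ j ∈ J, (∑ k ∈ L, B j k * v k) ^ 2 ≤ R * (C * ∑ k ∈ L, v k ^ 2) := by
  have h1 : ∀ j ∈ J, (∑ k ∈ L, B j k * v k) ^ 2 ≤ R * ∑ k ∈ L, B j k * v k ^ 2 := by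
    intro j hj
    have hnn : 0 ≤ ∑ k ∈ L, B j k * v k ^ 2 :=
      Finset.sum_nonneg fun k _ => mul_nonneg (hB j k) (sq_nonneg _)
    refine (Finset.sum_sq_le_sum_mul_sum_of_sq_le_mul L (fun k _ => hB j k)
      (g := fun k => B j k * v k ^ 2) (fun k _ => mul_nonneg (hB j k) (sq_nonneg _))
      (fun k _ => le_of_eq (by ring))).trans ?_
    exact mul_le_mul_of_nonneg_right (hrow j hj) hnn
  refine (Finset.sum_le_sum h1).trans ?_
  rw [← Finset.mul_sum, Finset.sum_comm]
  refine mul_le_mul_of_nonneg_left ?_ hR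
  rw [Finset.mul_sum]
  refine Finset.sum_le_sum fun k hk => ?_
  rw [← Finset.sum_mul]
  exact mul_le_mul_of_nonneg_right (hcol k hk) (sq_nonneg _)

/-- The weighted sums appearing in the Schur test. -/
theorem SymbH.sum_schur_le {d : ℕ} {s m ϱ : ℝ} (hs : (d : ℝ) / 2 < s) (hϱ : 0 ≤ ϱ)
    {a : Symb d} (ha : SymbH s m a) {p : Zd d} (hp : p ≠ 0) (T : Finset (Zd d)) (ν : Zd d ≃ Zd d)
    (η : Zd d → Rd d) {g : Zd d → ℝ} (hg0 : ∀ q, 0 ≤ g q)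
    (hg : ∀ q, g q ≤ ‖scoef a (ν q) (η q)‖)
    (hη : ∀ q, g q ≠ 0 → ∀ i, |η q i - p i| ≤ znorm p / (2 * (d + 1)))
    (hν : ∀ q, g q ≠ 0 → znorm (ν q) ≤ znorm p)
    (hq : ∀ q, g q ≠ 0 → znorm p / 2 ≤ znorm q ∧ znorm q ≤ 2 * znorm p)
    {e f : ℝ} (hef : e + f = -m - ϱ) :
    ∑ q ∈ T, znorm p ^ f * znorm q ^ e * g q ≤
      2 ^ |e| * (nearConst d m s * snormH (s - ϱ) m (2 * (d + 1)) a) := by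
  have hP0 : 0 < znorm p := one_pos.trans_le (one_le_znorm hp)
  set ξ : Zd d → Rd d := fun n => if g (ν.symm n) ≠ 0 then η (ν.symm n) else zR p with hξ
  have hclose : ∀ n i, |ξ n i - p i| ≤ znorm p / (2 * (d + 1)) := by
    intro n i
    by_cases h : g (ν.symm n) ≠ 0
    · simpa only [hξ, if_pos h] using hη _ h i
    · simp only [hξ, if_neg h, zR, sub_self, abs_zero]
      positivity
  have key := ha.sum_norm_scoef_le hs hϱ hp (T.map ν.toEmbedding) hclose
  rw [Finset.sum_map] at key
  have hterm : ∀ q ∈ T, znorm p ^ f * znorm q ^ e * g q ≤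
      2 ^ |e| * znorm p ^ (-m) * (japZ (ν q) ^ (-ϱ) * ‖scoef a (ν q) (ξ (ν q))‖) := by
    intro q _
    by_cases h : g q = 0
    · rw [h, mul_zero]
      exact mul_nonneg (by positivity)
        (mul_nonneg (Real.rpow_nonneg (japZ_pos _).le _) (norm_nonneg _))
    · have hξq : ξ (ν q) = η q := by simp [hξ, h]
      rw [hξq]
      have h1 := rpow_le_two_rpow_abs_mul hP0 (hq q h).1 (hq q h).2 e
      have h2 : znorm p ^ (-ϱ) ≤ japZ (ν q) ^ (-ϱ) :=
        Real.rpow_le_rpow_of_nonpos (japZ_pos _) (japZ_le_znorm hp (hν q h)) (by linarith)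
      calc znorm p ^ f * znorm q ^ e * g q
          ≤ znorm p ^ f * (2 ^ |e| * znorm p ^ e) * g q := by
            gcongr
            exact hg0 q
        _ = 2 ^ |e| * znorm p ^ (-m) * (znorm p ^ (-ϱ) * g q) := by
            have : znorm p ^ f * znorm p ^ e = znorm p ^ (-m) * znorm p ^ (-ϱ) := by
              rw [← Real.rpow_add hP0, ← Real.rpow_add hP0]
              congr 1
              linarith
            calc _ = 2 ^ |e| * (znorm p ^ f * znorm p ^ e) * g q := by ring
              _ = _ := by rw [this]; ring
        _ ≤ _ := by
            refine mul_le_mul_of_nonneg_left ?_ (by positivity)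
            exact mul_le_mul h2 (hg q) (hg0 q) (Real.rpow_nonneg (japZ_pos _).le _)
  refine (Finset.sum_le_sum hterm).trans ?_
  rw [← Finset.mul_sum]
  refine (mul_le_mul_of_nonneg_left key (by positivity)).trans (le_of_eq ?_)
  have : znorm p ^ (-m) * znorm p ^ m = 1 := by
    rw [← Real.rpow_add hP0]
    simp
  calc _ = 2 ^ |e| * (nearConst d m s * snormH (s - ϱ) m (2 * (d + 1)) a) *
        (znorm p ^ (-m) * znorm p ^ m) := by ring
    _ = _ := by rw [this, mul_one]

/-- Matrix entries of a Bony–Weyl operator in the Fourier basis. -/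
def bwEntry {d : ℕ} (χ : Rd d → ℝ) (ε : ℝ) (a : Symb d) (j k : Zd d) : ℂ :=
  scoef (achi χ ε a) (j - k) (fun i => ((j i : ℝ) + (k i : ℝ)) / 2)

/-- Fourier coefficients of the image of a function under a Bony–Weyl operator. -/
def bwCoef {d : ℕ} (χ : Rd d → ℝ) (ε : ℝ) (a : Symb d) (u : Fn d) (j : Zd d) : ℂ :=
  ∑' k : Zd d, bwEntry χ ε a j k * fcoef u k

theorem OpBW_eq {d : ℕ} (χ : Rd d → ℝ) (ε : ℝ) (a : Symb d) (u : Fn d) :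
    OpBW χ ε a u = fun x => ∑' j, bwCoef χ ε a u j * expChar j x := rfl

theorem OpBW_eq_zero_of_not_summable {d : ℕ} {χ : Rd d → ℝ} {ε : ℝ} {a : Symb d} {u : Fn d}
    (h : ¬ Summable fun j => ‖bwCoef χ ε a u j‖) : OpBW χ ε a u = fun _ => 0 := by
  rw [OpBW_eq]
  funext x
  refine tsum_eq_zero_of_not_summable fun hs => h ?_
  simpa only [norm_mul, norm_expChar, mul_one] using hs.norm

theorem fcoef_zero {d : ℕ} (n : Zd d) : fcoef (fun _ : Rd d => (0 : ℂ)) n = 0 := by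
  simp [fcoef]

theorem norm_fcoef_OpBW_le {d : ℕ} (χ : Rd d → ℝ) (ε : ℝ) (a : Symb d) (u : Fn d) (j : Zd d) :
    ‖fcoef (OpBW χ ε a u) j‖ ≤ ‖bwCoef χ ε a u j‖ := by
  by_cases h : Summable fun j => ‖bwCoef χ ε a u j‖
  · rw [OpBW_eq, fcoef_tsum_expChar h]
  · rw [OpBW_eq_zero_of_not_summable h, fcoef_zero, norm_zero]
    exact norm_nonneg _

theorem continuous_OpBW {d : ℕ} (χ : Rd d → ℝ) (ε : ℝ) (a : Symb d) (u : Fn d) :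
    Continuous (OpBW χ ε a u) := by
  by_cases h : Summable fun j => ‖bwCoef χ ε a u j‖
  · exact continuous_tsum_expChar h
  · rw [OpBW_eq_zero_of_not_summable h]
    exact continuous_const

theorem per_OpBW {d : ℕ} (χ : Rd d → ℝ) (ε : ℝ) (a : Symb d) (u : Fn d) :
    Per (OpBW χ ε a u) := by
  intro x j
  simp only [OpBW_eq, expChar_periodic]

section

variable {d : ℕ} {χ : Rd d → ℝ} {ε : ℝ}

theorem norm_bwEntry_le (hχ : IsCutoff χ) (hε : 0 < ε) (a : Symb d) (j k : Zd d) :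
    ‖bwEntry χ ε a j k‖ ≤ ‖scoef a (j - k) (fun i => ((j i : ℝ) + (k i : ℝ)) / 2)‖ :=
  norm_scoef_achi_le hχ hε a _ _

theorem znorm_le_of_bwEntry_ne_zero (hχ : IsCutoff χ) (hε : 0 < ε) (hε' : ε < 1 / (8 * (d + 1)))
    {a : Symb d} {j k : Zd d} (h : bwEntry χ ε a j k ≠ 0) :
    znorm (j - k) ≤ 1 / (4 * (d + 1)) * jap fun i => ((j i : ℝ) + (k i : ℝ)) / 2 := by
  rw [bwEntry, scoef_achi hχ hε] at h
  have h1 := hχ.znorm_lt hε (Complex.ofReal_ne_zero.1 (left_ne_zero_of_mul h))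
  refine h1.le.trans (mul_le_mul_of_nonneg_right ?_ (jap_pos _).le)
  have : (1 : ℝ) / (4 * (d + 1)) = 2 * (1 / (8 * (d + 1))) := by
    field_simp
    norm_num
  rw [this]
  linarith

theorem near_of_bwEntry_ne_zero (hχ : IsCutoff χ) (hε : 0 < ε) (hε' : ε < 1 / (8 * (d + 1)))
    {a : Symb d} {j k : Zd d} (h : bwEntry χ ε a j k ≠ 0) (hj : j ≠ 0) :
    znorm (j - k) ≤ znorm j / (d + 1) ∧ znorm j / 2 ≤ znorm k ∧ znorm k ≤ 2 * znorm j :=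
  znorm_near hj (znorm_le_of_bwEntry_ne_zero hχ hε hε' h)

theorem near_of_bwEntry_ne_zero' (hχ : IsCutoff χ) (hε : 0 < ε) (hε' : ε < 1 / (8 * (d + 1)))
    {a : Symb d} {j k : Zd d} (h : bwEntry χ ε a j k ≠ 0) (hk : k ≠ 0) :
    znorm (j - k) ≤ znorm k / (d + 1) ∧ znorm k / 2 ≤ znorm j ∧ znorm j ≤ 2 * znorm k := by
  have h1 := znorm_le_of_bwEntry_ne_zero hχ hε hε' h
  rw [znorm_sub_comm] at h1 ⊢
  simp only [add_comm (j _ : ℝ)] at h1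
  exact znorm_near hk h1

theorem znorm_zero : znorm (0 : Zd d) = 0 := by
  simp [znorm, enorm, zR]

theorem ne_zero_iff_of_bwEntry_ne_zero (hχ : IsCutoff χ) (hε : 0 < ε)
    (hε' : ε < 1 / (8 * (d + 1))) {a : Symb d} {j k : Zd d} (h : bwEntry χ ε a j k ≠ 0) :
    j ≠ 0 ↔ k ≠ 0 := by
  constructor
  · rintro hj rfl
    have h1 := (near_of_bwEntry_ne_zero hχ hε hε' h hj).2.1
    rw [znorm_zero] at h1
    linarith [one_le_znorm hj]
  · rintro hk rfl
    have h1 := (near_of_bwEntry_ne_zero' hχ hε hε' h hk).2.1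
    rw [znorm_zero] at h1
    linarith [one_le_znorm hk]

theorem bwCoef_zero (hχ : IsCutoff χ) (hε : 0 < ε) (hε' : ε < 1 / (8 * (d + 1)))
    (a : Symb d) {u : Fn d} (hu : fcoef u 0 = 0) : bwCoef χ ε a u 0 = 0 := by
  have : ∀ k, bwEntry χ ε a 0 k * fcoef u k = 0 := by
    intro k
    by_cases h : bwEntry χ ε a 0 k = 0
    · rw [h, zero_mul]
    · by_cases hk : k = 0
      · rw [hk, hu, mul_zero]
      · exact absurd rfl ((ne_zero_iff_of_bwEntry_ne_zero hχ hε hε' h).2 hk)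
  simp only [bwCoef, this, tsum_zero]

theorem exists_finset_norm_bwCoef_le (hχ : IsCutoff χ) (hε : 0 < ε) (hε' : ε < 1 / (8 * (d + 1)))
    (a : Symb d) (u : Fn d) (J : Finset (Zd d)) (hJ : ∀ j ∈ J, j ≠ 0) :
    ∃ L : Finset (Zd d), (∀ k ∈ L, k ≠ 0) ∧
      ∀ j ∈ J, ‖bwCoef χ ε a u j‖ ≤ ∑ k ∈ L, ‖bwEntry χ ε a j k‖ * ‖fcoef u k‖ := by
  have hfin : ∀ j : Zd d, {k : Zd d | znorm k ≤ 2 * znorm j}.Finite := fun j => finite_znorm_le d _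
  refine ⟨(J.biUnion fun j => (hfin j).toFinset).filter (· ≠ 0),
    fun k hk => (Finset.mem_filter.1 hk).2, fun j hj => ?_⟩
  rw [bwCoef, tsum_eq_sum
    (s := (J.biUnion fun j => (hfin j).toFinset).filter (· ≠ 0)) (fun k hk => ?_)]
  · refine (norm_sum_le _ _).trans (le_of_eq ?_)
    exact Finset.sum_congr rfl fun k _ => norm_mul _ _
  · by_contra hne
    have h := left_ne_zero_of_mul hne
    refine hk (Finset.mem_filter.2 ⟨Finset.mem_biUnion.2 ⟨j, hj, ?_⟩,
      (ne_zero_iff_of_bwEntry_ne_zero hχ hε hε' h).1 (hJ j hj)⟩)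
    rw [Set.Finite.mem_toFinset]
    exact (near_of_bwEntry_ne_zero hχ hε hε' h (hJ j hj)).2.2

theorem abs_half_sub_le (n : Zd d) {P : ℝ} (h : znorm n ≤ P / (d + 1)) (i : Fin d) :
    |(n i : ℝ) / 2| ≤ P / (2 * (d + 1)) := by
  rw [abs_div, abs_two, mul_comm (2 : ℝ), ← div_div]
  exact div_le_div_of_nonneg_right ((abs_apply_le_enorm (zR n) i).trans h) two_pos.le

theorem div_succ_le (d : ℕ) {P : ℝ} (hP : 0 ≤ P) : P / (d + 1) ≤ P :=
  div_le_self hP (by linarith [(Nat.cast_nonneg d : (0 : ℝ) ≤ d)])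

theorem SymbH.sum_row_le {s0 m ϱ : ℝ} (hs0 : (d : ℝ) / 2 < s0) (hϱ : 0 ≤ ϱ) (hχ : IsCutoff χ)
    (hε : 0 < ε) (hε' : ε < 1 / (8 * (d + 1))) {a : Symb d} (ha : SymbH s0 m a) {j : Zd d}
    (hj : j ≠ 0) (L : Finset (Zd d)) (s : ℝ) :
    ∑ k ∈ L, znorm j ^ (s - m - ϱ) * znorm k ^ (-s) * ‖bwEntry χ ε a j k‖ ≤
      2 ^ |s| * (nearConst d m s0 * snormH (s0 - ϱ) m (2 * (d + 1)) a) := by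
  have near := fun k (h : ‖bwEntry χ ε a j k‖ ≠ 0) =>
    near_of_bwEntry_ne_zero hχ hε hε' (norm_ne_zero_iff.1 h) hj
  rw [← abs_neg s]
  refine ha.sum_schur_le hs0 hϱ hj L (Equiv.subLeft j)
    (fun k i => ((j i : ℝ) + (k i : ℝ)) / 2) (fun k => norm_nonneg _)
    (fun k => norm_bwEntry_le hχ hε a j k) ?_ ?_ (fun k h => (near k h).2) (by ring)
  · intro k h i
    have h1 := abs_half_sub_le (j - k) (near k h).1 i
    rw [← abs_neg] at h1
    convert h1 using 2
    simp only [Pi.sub_apply, Int.cast_sub]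
    ring
  · exact fun k h => (near k h).1.trans (div_succ_le d (znorm_nonneg j))

theorem SymbH.sum_col_le {s0 m ϱ : ℝ} (hs0 : (d : ℝ) / 2 < s0) (hϱ : 0 ≤ ϱ) (hχ : IsCutoff χ)
    (hε : 0 < ε) (hε' : ε < 1 / (8 * (d + 1))) {a : Symb d} (ha : SymbH s0 m a) {k : Zd d}
    (hk : k ≠ 0) (J : Finset (Zd d)) (s : ℝ) :
    ∑ j ∈ J, znorm j ^ (s - m - ϱ) * znorm k ^ (-s) * ‖bwEntry χ ε a j k‖ ≤
      2 ^ |s - m - ϱ| * (nearConst d m s0 * snormH (s0 - ϱ) m (2 * (d + 1)) a) := by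
  have near := fun j (h : ‖bwEntry χ ε a j k‖ ≠ 0) =>
    near_of_bwEntry_ne_zero' hχ hε hε' (norm_ne_zero_iff.1 h) hk
  simp only [mul_comm (znorm _ ^ (s - m - ϱ))]
  refine ha.sum_schur_le hs0 hϱ hk J (Equiv.subRight k)
    (fun j i => ((j i : ℝ) + (k i : ℝ)) / 2) (fun j => norm_nonneg _)
    (fun j => norm_bwEntry_le hχ hε a j k) ?_ ?_ (fun j h => (near j h).2) (by ring)
  · intro j h i
    have h1 := abs_half_sub_le (j - k) (near j h).1 i
    convert h1 using 2
    simp only [Pi.sub_apply, Int.cast_sub]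
    ring
  · exact fun j h => (near j h).1.trans (div_succ_le d (znorm_nonneg k))

/-- The constant in the operator bound. -/
def bwConst (d : ℕ) (m s0 ϱ s : ℝ) : ℝ := (2 ^ |s| + 2 ^ |s - m - ϱ|) * (nearConst d m s0 + 1)

theorem bwConst_pos (d : ℕ) (m s0 ϱ s : ℝ) : 0 < bwConst d m s0 ϱ s := by
  have := nearConst_nonneg d m s0
  unfold bwConst
  positivity

theorem hsob_term_nonneg (s : ℝ) (u : Fn d) (j : Zd d) :
    0 ≤ znorm j ^ (2 * s) * ‖fcoef u j‖ ^ 2 :=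
  mul_nonneg (Real.rpow_nonneg (znorm_nonneg j) _) (by positivity)

theorem SymbH.sum_bwCoef_le {s0 m ϱ : ℝ} (hs0 : (d : ℝ) / 2 < s0) (hϱ : 0 ≤ ϱ) (hχ : IsCutoff χ)
    (hε : 0 < ε) (hε' : ε < 1 / (8 * (d + 1))) {a : Symb d} (ha : SymbH s0 m a) {s : ℝ}
    {u : Fn d} (hu : InHdot s u) (J : Finset (Zd d)) (hJ : ∀ j ∈ J, j ≠ 0) :
    ∑ j ∈ J, znorm j ^ (2 * (s - m - ϱ)) * ‖bwCoef χ ε a u j‖ ^ 2 ≤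
      (bwConst d m s0 ϱ s * snormH (s0 - ϱ) m (2 * (d + 1)) a) ^ 2 * hsobSq s u := by
  obtain ⟨L, hL, hLJ⟩ := exists_finset_norm_bwCoef_le hχ hε hε' a u J hJ
  set A := snormH (s0 - ϱ) m (2 * (d + 1)) a with hA
  have hA0 : 0 ≤ A := snormH_nonneg _ _ _ _
  have hn0 := nearConst_nonneg d m s0
  have hS := sum_sq_le_of_schur J L
    (B := fun j k => znorm j ^ (s - m - ϱ) * znorm k ^ (-s) * ‖bwEntry χ ε a j k‖)
    (fun j k => mul_nonneg (mul_nonneg (Real.rpow_nonneg (znorm_nonneg j) _)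
      (Real.rpow_nonneg (znorm_nonneg k) _)) (norm_nonneg _))
    (fun k => znorm k ^ s * ‖fcoef u k‖) (R := 2 ^ |s| * (nearConst d m s0 * A))
    (C := 2 ^ |s - m - ϱ| * (nearConst d m s0 * A)) (by positivity)
    (fun j hj => ha.sum_row_le hs0 hϱ hχ hε hε' (hJ j hj) L s)
    (fun k hk => ha.sum_col_le hs0 hϱ hχ hε hε' (hL k hk) J s)
  have hsq : ∀ (z : Zd d) (q y : ℝ), (znorm z ^ q * y) ^ 2 = znorm z ^ (2 * q) * y ^ 2 := by
    intro z q y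
    rw [mul_pow, ← Real.rpow_natCast (znorm z ^ q), ← Real.rpow_mul (znorm_nonneg z), mul_comm q]
    norm_num
  have h1 : ∑ j ∈ J, znorm j ^ (2 * (s - m - ϱ)) * ‖bwCoef χ ε a u j‖ ^ 2 ≤
      ∑ j ∈ J, (∑ k ∈ L, znorm j ^ (s - m - ϱ) * znorm k ^ (-s) * ‖bwEntry χ ε a j k‖ *
        (znorm k ^ s * ‖fcoef u k‖)) ^ 2 := by
    refine Finset.sum_le_sum fun j hj => ?_
    rw [← hsq]
    refine pow_le_pow_left₀
      (mul_nonneg (Real.rpow_nonneg (znorm_nonneg j) _) (norm_nonneg _)) ?_ 2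
    refine (mul_le_mul_of_nonneg_left (hLJ j hj)
      (Real.rpow_nonneg (znorm_nonneg j) _)).trans (le_of_eq ?_)
    rw [Finset.mul_sum]
    refine Finset.sum_congr rfl fun k hk => ?_
    have hk0 : 0 < znorm k := one_pos.trans_le (one_le_znorm (hL k hk))
    have : znorm k ^ (-s) * znorm k ^ s = 1 := by
      rw [← Real.rpow_add hk0]
      simp
    calc _ = znorm j ^ (s - m - ϱ) * (‖bwEntry χ ε a j k‖ * ‖fcoef u k‖) *
          (znorm k ^ (-s) * znorm k ^ s) := by rw [this, mul_one]
      _ = _ := by ring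
  have h2 : ∑ k ∈ L, (znorm k ^ s * ‖fcoef u k‖) ^ 2 ≤ hsobSq s u := by
    simp only [hsq]
    exact hu.2.2.2.sum_le_tsum L fun k _ => hsob_term_nonneg s u k
  have h3 : 0 ≤ hsobSq s u := tsum_nonneg fun k => hsob_term_nonneg s u k
  refine (h1.trans hS).trans ?_
  rw [← mul_assoc]
  refine mul_le_mul ?_ h2 (Finset.sum_nonneg fun k _ => sq_nonneg _) (sq_nonneg _)
  rw [bwConst]
  set X : ℝ := 2 ^ |s|
  set Y : ℝ := 2 ^ |s - m - ϱ|
  have hX : 0 < X := by positivity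
  have hY : 0 < Y := by positivity
  rw [sq]
  refine mul_le_mul ?_ ?_ (by positivity) (by positivity)
  · rw [mul_assoc]
    exact mul_le_mul (by linarith) (mul_le_mul_of_nonneg_right (by linarith) hA0)
      (by positivity) (by positivity)
  · rw [mul_assoc]
    exact mul_le_mul (by linarith) (mul_le_mul_of_nonneg_right (by linarith) hA0)
      (by positivity) (by positivity)

theorem SymbH.sum_fcoef_OpBW_le {s0 m ϱ : ℝ} (hs0 : (d : ℝ) / 2 < s0) (hϱ : 0 ≤ ϱ)
    (hχ : IsCutoff χ) (hε : 0 < ε) (hε' : ε < 1 / (8 * (d + 1))) {a : Symb d} (ha : SymbH s0 m a)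
    {s : ℝ} {u : Fn d} (hu : InHdot s u) (J : Finset (Zd d)) :
    ∑ j ∈ J, znorm j ^ (2 * (s - m - ϱ)) * ‖fcoef (OpBW χ ε a u) j‖ ^ 2 ≤
      (bwConst d m s0 ϱ s * snormH (s0 - ϱ) m (2 * (d + 1)) a) ^ 2 * hsobSq s u := by
  refine le_trans ?_ (ha.sum_bwCoef_le hs0 hϱ hχ hε hε' hu (J.filter (· ≠ 0))
    fun j hj => (Finset.mem_filter.1 hj).2)
  rw [← Finset.sum_filter_of_ne (p := (· ≠ 0))]
  · refine Finset.sum_le_sum fun j _ => mul_le_mul_of_nonneg_left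
      (pow_le_pow_left₀ (norm_nonneg _) (norm_fcoef_OpBW_le χ ε a u j) 2)
      (Real.rpow_nonneg (znorm_nonneg j) _)
  · rintro j _ hne rfl
    have h := norm_fcoef_OpBW_le χ ε a u 0
    rw [bwCoef_zero hχ hε hε' a hu.2.2.1, norm_zero] at h
    exact hne (by rw [le_antisymm h (norm_nonneg _)]; simp)

theorem SymbH.inHdot_OpBW {s0 m : ℝ} (hs0 : (d : ℝ) / 2 < s0)
    (hχ : IsCutoff χ) (hε : 0 < ε) (hε' : ε < 1 / (8 * (d + 1))) {a : Symb d} (ha : SymbH s0 m a)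
    {s : ℝ} {u : Fn d} (hu : InHdot s u) : InHdot (s - m) (OpBW χ ε a u) := by
  refine ⟨per_OpBW χ ε a u, (continuous_OpBW χ ε a u).locallyIntegrable, ?_, ?_⟩
  · have h := norm_fcoef_OpBW_le χ ε a u 0
    rw [bwCoef_zero hχ hε hε' a hu.2.2.1, norm_zero] at h
    exact norm_le_zero_iff.1 h
  · have h := ha.sum_fcoef_OpBW_le hs0 le_rfl hχ hε hε' hu
    simp only [sub_zero] at h
    exact summable_of_sum_le (fun j => hsob_term_nonneg _ _ j) h

theorem SymbH.hnorm_OpBW_le {s0 m ϱ : ℝ} (hs0 : (d : ℝ) / 2 < s0) (hϱ : 0 ≤ ϱ)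
    (hχ : IsCutoff χ) (hε : 0 < ε) (hε' : ε < 1 / (8 * (d + 1))) {a : Symb d} (ha : SymbH s0 m a)
    {s : ℝ} {u : Fn d} (hu : InHdot s u) :
    hnorm (s - m - ϱ) (OpBW χ ε a u) ≤
      bwConst d m s0 ϱ s * snormH (s0 - ϱ) m (2 * (d + 1)) a * hnorm s u := by
  have h := ha.sum_fcoef_OpBW_le hs0 hϱ hχ hε hε' hu
  have h1 : hsobSq (s - m - ϱ) (OpBW χ ε a u) ≤
      (bwConst d m s0 ϱ s * snormH (s0 - ϱ) m (2 * (d + 1)) a) ^ 2 * hsobSq s u :=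
    (summable_of_sum_le (fun j => hsob_term_nonneg _ _ j) h).tsum_le_of_sum_le h
  refine (Real.sqrt_le_sqrt h1).trans (le_of_eq ?_)
  rw [Real.sqrt_mul (sq_nonneg _), Real.sqrt_sq
    (mul_nonneg (bwConst_pos d m s0 ϱ s).le (snormH_nonneg _ _ _ _)), hnorm]

end

end EK

/-- **Continuity of Bony–Weyl operators.**
Let m ∈ ℝ, s₀ > d/2 and a ∈ Γ^m_{H^{s₀}}.  For ε in the cut-off small enough,
Op^BW(a) extends to a bounded operator Ḣ^s → Ḣ^{s−m} for every s ∈ ℝ, with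
‖Op^BW(a)u‖_{s−m} ≲ |a|_{m,s₀,2(d+1)} ‖u‖_s; moreover, for every ϱ ≥ 0 and s ∈ ℝ,
‖Op^BW(a)u‖_{s−m−ϱ} ≲ |a|_{m,s₀−ϱ,2(d+1)} ‖u‖_s. -/
theorem stmt2 (d : ℕ) (m s0 : ℝ) (hs0 : (d : ℝ) / 2 < s0)
    (χ : EK.Rd d → ℝ) (hχ : EK.IsCutoff χ) :
    ∃ ε0 ∈ Set.Ioo (0 : ℝ) 1, ∀ ε ∈ Set.Ioo (0 : ℝ) ε0,
      (∀ s : ℝ, ∃ C > 0, ∀ a : EK.Symb d, EK.SymbH s0 m a →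
        ∀ u : EK.Fn d, EK.InHdot s u →
          EK.InHdot (s - m) (EK.OpBW χ ε a u) ∧
          EK.hnorm (s - m) (EK.OpBW χ ε a u)
            ≤ C * EK.snormH s0 m (2 * (d + 1)) a * EK.hnorm s u) ∧
      (∀ ϱ : ℝ, 0 ≤ ϱ → ∀ s : ℝ, ∃ C > 0, ∀ a : EK.Symb d, EK.SymbH s0 m a →
        ∀ u : EK.Fn d, EK.InHdot s u →
          EK.hnorm (s - m - ϱ) (EK.OpBW χ ε a u)
            ≤ C * EK.snormH (s0 - ϱ) m (2 * (d + 1)) a * EK.hnorm s u) := by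
  have hd : (0 : ℝ) ≤ d := Nat.cast_nonneg d
  refine ⟨1 / (8 * (d + 1)), ⟨by positivity, ?_⟩, fun ε hε => ⟨fun s => ?_, fun ϱ hϱ s => ?_⟩⟩
  · rw [div_lt_one (by positivity)]
    linarith
  · refine ⟨EK.bwConst d m s0 0 s, EK.bwConst_pos _ _ _ _ _, fun a ha u hu =>
      ⟨ha.inHdot_OpBW hs0 hχ hε.1 hε.2 hu, ?_⟩⟩
    simpa only [sub_zero] using ha.hnorm_OpBW_le hs0 le_rfl hχ hε.1 hε.2 hu
  · exact ⟨EK.bwConst d m s0 ϱ s, EK.bwConst_pos _ _ _ _ _, fun a ha u hu =>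
      ha.hnorm_OpBW_le hs0 hϱ hχ hε.1 hε.2 hu⟩
end
end

section
/- Exact diagonalization of the principal symbol: let 0 < 𝚖₁ < 𝚖 < 𝚖₂, let K : ℝ₊ → ℝ be smooth with c_K ≤ K ≤ C_K on (𝚖₁,𝚖₂) for some constants c_K, C_K > 0, and let ρ ∈ ℝ with 𝚖₁ < 𝚖 + ρ < 𝚖₂. Set a_± := ½( (K(𝚖+ρ)−K(𝚖))/K(𝚖) ± ρ/𝚖 ) and λ := √((1+a₊)² − a₋²). Then: (i) λ = √((𝚖+ρ)K(𝚖+ρ)/(𝚖K(𝚖))), and √(𝚖₁c_K/(𝚖K(𝚖))) ≤ λ ≤ √(𝚖₂C_K/(𝚖K(𝚖))); (ii) (1+a₊+λ)² − a₋² = (K(𝚖+ρ)/K(𝚖) + λ)((𝚖+ρ)/𝚖 + λ) > (𝚖+ρ)K(𝚖+ρ)/(𝚖K(𝚖)) ≥ 𝚖₁c_K/(𝚖K(𝚖)) > 0; (iii) setting f := (1+a₊+λ)/√((1+a₊+λ)²−a₋²) and g := −a₋/√((1+a₊+λ)²−a₋²), one has f² − g² = 1, so the 2×2 matrix F := [[f,g],[g,f]]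 has determinant 1 and inverse F^{−1} = [[f,−g],[−g,f]]; (iv) with 𝕁 := diag(−i, i), the matrix identity F^{−1} · 𝕁[[1+a₊, a₋],[a₋, 1+a₊]] · F = 𝕁λ holds, so the eigenvalues of 𝕁[[1+a₊,a₋],[a₋,1+a₊]] are ±iλ. -/
/-!  Common setting: Sobolev spaces, paradifferential calculus and the
Euler–Korteweg system on the torus 𝕋^d = (ℝ/2πℤ)^d, modelled by
2π-periodic functions on ℝ^d and their Fourier coefficients. -/

noncomputable section
open scoped BigOperators Classical
open MeasureTheory

/-- Algebra of the symmetric hyperbolic rotation with entries `(p + l) / s` and `-q / s`, where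
`l ^ 2 = p ^ 2 - q ^ 2` and `s ^ 2 = (p + l) ^ 2 - q ^ 2`: the pair `(f, g)` is normalized
and the symmetric matrix with rows `(p, q)`, `(q, p)` maps it to `(l f, -l g)`. -/
lemma hyperbolic_rotation_identities {p q l f g : ℝ} (hl : l ^ 2 = p ^ 2 - q ^ 2)
    (hD : 0 < (p + l) ^ 2 - q ^ 2)
    (hf : f = (p + l) / Real.sqrt ((p + l) ^ 2 - q ^ 2))
    (hg : g = -q / Real.sqrt ((p + l) ^ 2 - q ^ 2)) :
    f ^ 2 - g ^ 2 = 1 ∧ p * f + q * g = l * f ∧ q * f + p * g = -(l * g) := by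
  have hs : Real.sqrt ((p + l) ^ 2 - q ^ 2) ≠ 0 := (Real.sqrt_pos.2 hD).ne'
  have hs2 := Real.sq_sqrt hD.le
  generalize Real.sqrt ((p + l) ^ 2 - q ^ 2) = s at *
  subst hf hg
  refine ⟨?_, ?_, ?_⟩
  · field_simp
    linarith
  · field_simp
    linarith
  · field_simp
    ring

/-- **Exact diagonalization of the principal symbol.**
With a_± = ½((K(𝚖+ρ)−K(𝚖))/K(𝚖) ± ρ/𝚖) and λ = √((1+a₊)²−a₋²):
(i) λ = √((𝚖+ρ)K(𝚖+ρ)/(𝚖K(𝚖))) with the two-sided bounds;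
(ii) the factorization and lower bounds for (1+a₊+λ)²−a₋²;
(iii) f²−g²=1, det F = 1 and F⁻¹ = [[f,−g],[−g,f]];
(iv) F⁻¹·𝕁[[1+a₊,a₋],[a₋,1+a₊]]·F = λ𝕁, so the eigenvalues are ±iλ. -/
theorem stmt6 (K : ℝ → ℝ) (m m1 m2 cK CK ρ aP aM lam f g : ℝ)
    (hm1 : 0 < m1) (h1m : m1 < m) (hm2 : m < m2) (hcK : 0 < cK)
    (hKb : ∀ t ∈ Set.Ioo m1 m2, cK ≤ K t ∧ K t ≤ CK)
    (hρ1 : m1 < m + ρ) (hρ2 : m + ρ < m2)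
    (haP : aP = 1 / 2 * ((K (m + ρ) - K m) / K m + ρ / m))
    (haM : aM = 1 / 2 * ((K (m + ρ) - K m) / K m - ρ / m))
    (hlam : lam = Real.sqrt ((1 + aP) ^ 2 - aM ^ 2))
    (hf : f = (1 + aP + lam) / Real.sqrt ((1 + aP + lam) ^ 2 - aM ^ 2))
    (hg : g = -aM / Real.sqrt ((1 + aP + lam) ^ 2 - aM ^ 2)) :
    -- (i)
    (lam = Real.sqrt ((m + ρ) * K (m + ρ) / (m * K m)) ∧
      Real.sqrt (m1 * cK / (m * K m)) ≤ lam ∧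
      lam ≤ Real.sqrt (m2 * CK / (m * K m))) ∧
    -- (ii)
    ((1 + aP + lam) ^ 2 - aM ^ 2 = (K (m + ρ) / K m + lam) * ((m + ρ) / m + lam) ∧
      (m + ρ) * K (m + ρ) / (m * K m) < (1 + aP + lam) ^ 2 - aM ^ 2 ∧
      m1 * cK / (m * K m) ≤ (m + ρ) * K (m + ρ) / (m * K m) ∧
      0 < m1 * cK / (m * K m)) ∧
    -- (iii)
    (f ^ 2 - g ^ 2 = 1 ∧
      Matrix.det !![(f : ℂ), (g : ℂ); (g : ℂ), (f : ℂ)] = 1 ∧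
      !![(f : ℂ), (g : ℂ); (g : ℂ), (f : ℂ)] *
        !![(f : ℂ), -(g : ℂ); -(g : ℂ), (f : ℂ)] = 1 ∧
      !![(f : ℂ), -(g : ℂ); -(g : ℂ), (f : ℂ)] *
        !![(f : ℂ), (g : ℂ); (g : ℂ), (f : ℂ)] = 1) ∧
    -- (iv)
    (!![(f : ℂ), -(g : ℂ); -(g : ℂ), (f : ℂ)] *
        (!![-Complex.I, 0; 0, Complex.I] *
          !![(1 + aP : ℂ), (aM : ℂ); (aM : ℂ), (1 + aP : ℂ)]) *
        !![(f : ℂ), (g : ℂ); (g : ℂ), (f : ℂ)]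
      = (lam : ℂ) • !![-Complex.I, 0; 0, Complex.I] ∧
    (∃ v : Fin 2 → ℂ, v ≠ 0 ∧
      Matrix.mulVec
        (!![-Complex.I, 0; 0, Complex.I] *
          !![(1 + aP : ℂ), (aM : ℂ); (aM : ℂ), (1 + aP : ℂ)]) v
        = (Complex.I * (lam : ℂ)) • v) ∧
    (∃ w : Fin 2 → ℂ, w ≠ 0 ∧
      Matrix.mulVec
        (!![-Complex.I, 0; 0, Complex.I] *
          !![(1 + aP : ℂ), (aM : ℂ); (aM : ℂ), (1 + aP : ℂ)]) w
        = (-(Complex.I * (lam : ℂ))) • w)) := by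
  have hm : 0 < m := hm1.trans h1m
  have hr : 0 < m + ρ := hm1.trans hρ1
  obtain ⟨hKr, hKr'⟩ := hKb (m + ρ) ⟨hρ1, hρ2⟩
  have hKm : 0 < K m := hcK.trans_le (hKb m ⟨h1m, hm2⟩).1
  have hKρ : 0 < K (m + ρ) := hcK.trans_le hKr
  have hsum : 1 + aP + aM = K (m + ρ) / K m := by
    rw [haP, haM]
    field_simp
    ring
  have hdiff : 1 + aP - aM = (m + ρ) / m := by
    rw [haP, haM]
    field_simp
    ring
  have hprod : (1 + aP) ^ 2 - aM ^ 2 = (m + ρ) * K (m + ρ) / (m * K m) := by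
    rw [mul_div_mul_comm, ← hsum, ← hdiff]
    ring
  have hQ : 0 < (m + ρ) * K (m + ρ) / (m * K m) := by positivity
  have hl : 0 < lam := by
    rw [hlam, hprod]
    exact Real.sqrt_pos.2 hQ
  have hl2 : lam ^ 2 = (1 + aP) ^ 2 - aM ^ 2 := by
    rw [hlam, Real.sq_sqrt (hprod ▸ hQ.le)]
  have hfac : (1 + aP + lam) ^ 2 - aM ^ 2 = (K (m + ρ) / K m + lam) * ((m + ρ) / m + lam) := by
    rw [← hsum, ← hdiff]
    ring
  have hlt : (m + ρ) * K (m + ρ) / (m * K m) < (1 + aP + lam) ^ 2 - aM ^ 2 := by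
    have h1 : 0 < K (m + ρ) / K m := by positivity
    have h2 : 0 < (m + ρ) / m := by positivity
    rw [hfac, mul_comm (m + ρ), mul_comm m, mul_div_mul_comm]
    gcongr <;> linarith
  have hlow : m1 * cK / (m * K m) ≤ (m + ρ) * K (m + ρ) / (m * K m) := by gcongr
  have hm20 : 0 < m2 := hm.trans hm2
  have hhigh : (m + ρ) * K (m + ρ) / (m * K m) ≤ m2 * CK / (m * K m) := by gcongr
  have hi : lam = Real.sqrt ((m + ρ) * K (m + ρ) / (m * K m)) := by rw [hlam, hprod]
  obtain ⟨hfg, hpf, hqf⟩ := hyperbolic_rotation_identities hl2 (hQ.trans hlt) hf hg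
  have hf0 : (f : ℂ) ≠ 0 := by
    rw [Complex.ofReal_ne_zero]
    rintro rfl
    nlinarith [sq_nonneg g]
  have cfg : (f : ℂ) ^ 2 - (g : ℂ) ^ 2 = 1 := by exact_mod_cast hfg
  have cpf : (1 + aP : ℂ) * f + aM * g = lam * f := by exact_mod_cast hpf
  have cqf : (aM : ℂ) * f + (1 + aP) * g = -(lam * g) := by exact_mod_cast hqf
  refine ⟨⟨hi, ?_, ?_⟩, ⟨hfac, hlt, hlow, by positivity⟩, ⟨hfg, ?_, ?_, ?_⟩, ?_,
    ⟨![g, f], ?_, ?_⟩, ⟨![f, g], ?_, ?_⟩⟩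
  · rw [hi]
    exact Real.sqrt_le_sqrt hlow
  · rw [hi]
    exact Real.sqrt_le_sqrt hhigh
  · rw [Matrix.det_fin_two_of]
    linear_combination cfg
  · ext i j
    fin_cases i <;> fin_cases j <;> simp [Matrix.mul_apply, Fin.sum_univ_two] <;>
      first | linear_combination cfg | ring
  · ext i j
    fin_cases i <;> fin_cases j <;> simp [Matrix.mul_apply, Fin.sum_univ_two] <;>
      first | linear_combination cfg | ring
  · ext i j
    fin_cases i <;> fin_cases j <;> simp [Matrix.mul_apply, Fin.sum_univ_two]
    · linear_combination
        -Complex.I * f * cpf - Complex.I * g * cqf - Complex.I * lam * cfg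
    · linear_combination -Complex.I * f * cqf - Complex.I * g * cpf
    · linear_combination Complex.I * f * cqf + Complex.I * g * cpf
    · linear_combination
        Complex.I * f * cpf + Complex.I * g * cqf + Complex.I * lam * cfg
  · exact fun h => hf0 (by simpa using congrFun h 1)
  · ext i
    fin_cases i <;> simp [Matrix.mulVec, dotProduct, Matrix.mul_apply, Fin.sum_univ_two]
    · linear_combination -Complex.I * cqf
    · linear_combination Complex.I * cpf
  · exact fun h => hf0 (by simpa using congrFun h 0)
  · ext i
    fin_cases i <;> simp [Matrix.mulVec, dotProduct, Matrix.mul_apply, Fin.sum_univ_two]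
    · linear_combination -Complex.I * cpf
    · linear_combination Complex.I * cqf
end
end

section
/- Kernel integral estimate on the torus: let K : 𝕋^d → ℂ satisfy, for some constants A, B > 0, the bound |K(y)| ≲ A^d B min( 1, min_{1≤m≤d} 1/|A·2sin(y_m/2)|^{d+1} ) for all y ∈ 𝕋^d. Then ∫_{𝕋^d} |K(y)| dy ≲ B, with an implied constant depending only on d and on the implied constant in the hypothesis. -/
/-!  Common setting: Sobolev spaces, paradifferential calculus and the
Euler–Korteweg system on the torus 𝕋^d = (ℝ/2πℤ)^d, modelled by
2π-periodic functions on ℝ^d and their Fourier coefficients. -/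

noncomputable section
open scoped BigOperators Classical
open MeasureTheory

/-- A lower bound for the chord length `2 sin (y / 2)` on the first half of the circle. -/
theorem half_le_two_mul_sin_half {y : ℝ} (h0 : 0 ≤ y) (h1 : y ≤ Real.pi) :
    y / 2 ≤ 2 * Real.sin (y / 2) := by
  have h := Real.mul_le_sin (x := y / 2) (by linarith) (by linarith)
  have h2 : 1 / 2 * (y / 2) ≤ 2 / Real.pi * (y / 2) := by
    apply mul_le_mul_of_nonneg_right _ (by linarith)
    rw [div_le_div_iff₀ (by norm_num) Real.pi_pos]
    linarith [Real.pi_le_four]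
  linarith

/-- The truncated power `min 1 (t ^ (-n))` is dominated by a power of `4 / (1 + s)`
when `s ≤ 2 t`. -/
theorem min_one_div_pow_le {s t : ℝ} (hs : 0 ≤ s) (hst : s / 2 ≤ t) (n : ℕ) :
    min 1 (1 / t ^ n) ≤ (4 / (1 + s)) ^ n := by
  rcases le_total t 1 with h | h
  · refine (min_le_left _ _).trans (one_le_pow₀ ?_)
    rw [le_div_iff₀ (by linarith)]
    linarith
  · refine (min_le_right _ _).trans ?_
    rw [← one_div_pow]
    refine pow_le_pow_left₀ (by positivity) ?_ n
    rw [div_le_div_iff₀ (by linarith) (by linarith)]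
    linarith

theorem four_div_pow_succ_le {d : ℕ} (hd : 0 < d) {s : ℝ} (hs : 0 ≤ s) :
    (4 / (1 + s)) ^ (d + 1) ≤ (16 * (1 + s) ^ (-(((d : ℝ) + 1) / d))) ^ d := by
  have hd' : (0 : ℝ) < d := by exact_mod_cast hd
  have h1 : ((1 + s) ^ (-(((d : ℝ) + 1) / d))) ^ d = ((1 + s) ^ (d + 1))⁻¹ := by
    rw [← Real.rpow_natCast, ← Real.rpow_mul (by linarith), ← Real.rpow_natCast,
      ← Real.rpow_neg (by linarith)]
    congr 1
    push_cast
    field_simp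
  have h2 : (4 : ℝ) ^ (d + 1) ≤ 16 ^ d := by
    rw [show (16 : ℝ) = 4 ^ 2 by norm_num, ← pow_mul]
    exact pow_le_pow_right₀ (by norm_num) (by omega)
  rw [mul_pow, h1, div_pow, div_eq_mul_inv]
  exact mul_le_mul_of_nonneg_right h2 (by positivity)

/-- A one-dimensional majorant of the `d`-th root of the kernel bound, on a period. -/
def kernelMajorant (d : ℕ) (A y : ℝ) : ℝ :=
  16 * (1 + ‖A * y‖) ^ (-(((d : ℝ) + 1) / d)) +
    16 * (1 + ‖A * (2 * Real.pi - y)‖) ^ (-(((d : ℝ) + 1) / d))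

theorem kernelMajorant_nonneg (d : ℕ) (A y : ℝ) : 0 ≤ kernelMajorant d A y := by
  unfold kernelMajorant
  positivity

theorem min_one_div_sin_pow_le {d : ℕ} (hd : 0 < d) {A y : ℝ} (hA : 0 < A)
    (hy : y ∈ Set.Ioc 0 (2 * Real.pi)) :
    min 1 (1 / |A * (2 * Real.sin (y / 2))| ^ (d + 1)) ≤ kernelMajorant d A y ^ d := by
  have key : ∀ z : ℝ, 0 ≤ z → z ≤ Real.pi → Real.sin (z / 2) = Real.sin (y / 2) →
      min 1 (1 / |A * (2 * Real.sin (y / 2))| ^ (d + 1)) ≤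
        (16 * (1 + ‖A * z‖) ^ (-(((d : ℝ) + 1) / d))) ^ d := by
    intro z h0 h1 hz
    have hn : ‖A * z‖ = A * z := by
      rw [Real.norm_eq_abs, abs_of_nonneg (by positivity)]
    refine (min_one_div_pow_le (norm_nonneg (A * z)) ?_ (d + 1)).trans
      (four_div_pow_succ_le hd (norm_nonneg _))
    rw [hn, ← hz]
    refine le_trans ?_ (le_abs_self _)
    have := mul_le_mul_of_nonneg_left (half_le_two_mul_sin_half h0 h1) hA.le
    linarith
  rcases le_total y Real.pi with h | h
  · refine (key y hy.1.le h rfl).trans (pow_le_pow_left₀ (by positivity) ?_ d)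
    exact le_add_of_nonneg_right (by positivity)
  · refine (key (2 * Real.pi - y) (by linarith [hy.2]) (by linarith) ?_).trans
      (pow_le_pow_left₀ (by positivity) ?_ d)
    · rw [show (2 * Real.pi - y) / 2 = Real.pi - y / 2 by ring, Real.sin_pi_sub]
    · exact le_add_of_nonneg_left (by positivity)

theorem integrable_one_add_norm_rpow_succ_div {d : ℕ} (hd : 0 < d) :
    Integrable fun s : ℝ => (1 + ‖s‖) ^ (-(((d : ℝ) + 1) / d)) := by
  have hd' : (0 : ℝ) < d := by exact_mod_cast hd
  apply integrable_one_add_norm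
  rw [Module.finrank_self, Nat.cast_one, lt_div_iff₀ hd']
  linarith

theorem integrable_kernelMajorant {d : ℕ} (hd : 0 < d) {A : ℝ} (hA : 0 < A) :
    Integrable (kernelMajorant d A) := by
  have h := (integrable_one_add_norm_rpow_succ_div hd).comp_mul_left' hA.ne'
  exact (h.const_mul 16).add ((h.comp_sub_left (2 * Real.pi)).const_mul 16)

theorem integral_kernelMajorant {d : ℕ} (hd : 0 < d) {A : ℝ} (hA : 0 < A) :
    ∫ y, kernelMajorant d A y =
      A⁻¹ * (32 * ∫ s : ℝ, (1 + ‖s‖) ^ (-(((d : ℝ) + 1) / d))) := by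
  have h := (integrable_one_add_norm_rpow_succ_div hd).comp_mul_left' hA.ne'
  unfold kernelMajorant
  rw [integral_add (h.const_mul 16) ((h.comp_sub_left (2 * Real.pi)).const_mul 16),
    integral_const_mul, integral_const_mul,
    integral_sub_left_eq_self (fun y : ℝ => (1 + ‖A * y‖) ^ (-(((d : ℝ) + 1) / d))) volume,
    Measure.integral_comp_mul_left (fun s : ℝ => (1 + ‖s‖) ^ (-(((d : ℝ) + 1) / d))) A,
    abs_of_pos (inv_pos.2 hA), smul_eq_mul]
  ring

theorem min_one_iInf_le_prod_kernelMajorant {d : ℕ} (hd : 0 < d) {A : ℝ} (hA : 0 < A)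
    {y : EK.Rd d} (hy : y ∈ EK.box d) :
    min 1 (⨅ i : Fin d, 1 / |A * (2 * Real.sin (y i / 2))| ^ (d + 1)) ≤
      ∏ i, kernelMajorant d A (y i) := by
  set M := min 1 (⨅ i : Fin d, 1 / |A * (2 * Real.sin (y i / 2))| ^ (d + 1)) with hM
  have hM0 : 0 ≤ M := le_min zero_le_one (Real.iInf_nonneg fun i => by positivity)
  have hle : ∀ i, M ≤ kernelMajorant d A (y i) ^ d := fun i =>
    (min_le_min_left 1 (ciInf_le (Set.finite_range _).bddBelow i)).trans
      (min_one_div_sin_pow_le hd hA (hy i (Set.mem_univ i)))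
  refine le_of_pow_le_pow_left₀ hd.ne'
    (Finset.prod_nonneg fun i _ => kernelMajorant_nonneg d A (y i)) ?_
  calc M ^ d = ∏ _i : Fin d, M := by simp
    _ ≤ ∏ i, kernelMajorant d A (y i) ^ d :=
      Finset.prod_le_prod (fun _ _ => hM0) fun i _ => hle i
    _ = (∏ i, kernelMajorant d A (y i)) ^ d := Finset.prod_pow _ _ _

/-- **Kernel integral estimate on the torus.**
If |K(y)| ≲ A^d B min(1, min_m 1/|A·2sin(y_m/2)|^{d+1}) for all y, then
∫_{𝕋^d} |K(y)| dy ≲ B, with constant depending only on d and on the implied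
constant of the hypothesis. -/
theorem stmt14 (d : ℕ) (hd : 0 < d) (C0 : ℝ) (hC0 : 0 < C0) :
    ∃ C > 0, ∀ (Kk : EK.Fn d) (A B : ℝ), 0 < A → 0 < B → Measurable Kk →
      (∀ y : EK.Rd d, ‖Kk y‖ ≤ C0 * A ^ d * B *
        min 1 (⨅ i : Fin d, 1 / |A * (2 * Real.sin (y i / 2))| ^ (d + 1))) →
      (∫ y in EK.box d, ‖Kk y‖) ≤ C * B := by
  set I := ∫ s : ℝ, (1 + ‖s‖) ^ (-(((d : ℝ) + 1) / d)) with hI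
  have hI0 : 0 ≤ I := integral_nonneg fun s => by positivity
  refine ⟨C0 * (32 * I) ^ d + 1, by positivity, fun Kk A B hA hB _ hK => ?_⟩
  have hint : Integrable fun y : EK.Rd d =>
      C0 * A ^ d * B * ∏ i, kernelMajorant d A (y i) :=
    (Integrable.fintype_prod (f := fun _ : Fin d => kernelMajorant d A)
      fun _ => integrable_kernelMajorant hd hA).const_mul _
  have hnn : ∀ y : EK.Rd d, 0 ≤ C0 * A ^ d * B * ∏ i, kernelMajorant d A (y i) := fun y =>
    mul_nonneg (by positivity) (Finset.prod_nonneg fun i _ => kernelMajorant_nonneg d A (y i))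
  have hbox : MeasurableSet (EK.box d) :=
    MeasurableSet.univ_pi fun _ => measurableSet_Ioc
  calc (∫ y in EK.box d, ‖Kk y‖)
      ≤ ∫ y in EK.box d, C0 * A ^ d * B * ∏ i, kernelMajorant d A (y i) := by
        refine integral_mono_of_nonneg (Filter.Eventually.of_forall fun y => norm_nonneg _)
          hint.integrableOn ((ae_restrict_iff' hbox).2 (Filter.Eventually.of_forall ?_))
        exact fun y hy => (hK y).trans (mul_le_mul_of_nonneg_left
          (min_one_iInf_le_prod_kernelMajorant hd hA hy) (by positivity))
    _ ≤ ∫ y : EK.Rd d, C0 * A ^ d * B * ∏ i, kernelMajorant d A (y i) :=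
        setIntegral_le_integral hint (Filter.Eventually.of_forall hnn)
    _ = C0 * (32 * I) ^ d * B := by
        rw [integral_const_mul, integral_fintype_prod_volume_eq_pow (kernelMajorant d A),
          integral_kernelMajorant hd hA, Fintype.card_fin, ← hI, mul_pow, inv_pow]
        field_simp
    _ ≤ (C0 * (32 * I) ^ d + 1) * B := by linarith
end
end
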